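/- Every brick G different from K_4 and the triangular prism C̄_6 has at least Δ(G) - 2 removable edges, where Δ(G) is the maximum degree of G. -/

import Mathlib

open Classical in
/-- A finite multigraph: loops are forbidden, multiple edges are allowed. -/
structure Multigraph where
  V : Type
  E : Type
  [fintV : Fintype V]
  [fintE : Fintype E]
  ends : E → Sym2 V
  no_loops : ∀ e, ¬ (ends e).IsDiag

attribute [instance] Multigraph.fintV Multigraph.fintE

namespace Multigraph

variable (G : Multigraph)

/-- Vertex `v` is incident with edge `e`. -/
def Inc (v : G.V) (e : G.E) : Prop := v ∈ G.ends e

/-- Adjacency of vertices. -/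
def Adj (u v : G.V) : Prop := u ≠ v ∧ ∃ e, G.ends e = s(u, v)

/-- A multigraph is connected. -/
def Connected : Prop := Nonempty G.V ∧ ∀ u v : G.V, Relation.ReflTransGen G.Adj u v

/-- A set of edges is a perfect matching: every vertex is covered exactly once. -/
def IsPerfectMatching (M : Set G.E) : Prop :=
  ∀ v : G.V, ∃! e, e ∈ M ∧ G.Inc v e

/-- Matching covered: nontrivial, connected, every edge lies in a perfect matching. -/
def MatchingCovered : Prop :=
  2 ≤ Nat.card G.V ∧ G.Connected ∧ ∀ e : G.E, ∃ M, G.IsPerfectMatching M ∧ e ∈ M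

/-- Degree of a vertex. -/
noncomputable def degree (v : G.V) : ℕ := Nat.card {e : G.E // G.Inc v e}

/-- Maximum degree `Δ(G)`. -/
noncomputable def maxDegree : ℕ := Finset.univ.sup G.degree

/-- The graph obtained by deleting the edge `e`. -/
noncomputable def deleteEdge (e : G.E) : Multigraph where
  V := G.V
  E := {f : G.E // f ≠ e}
  fintE := Fintype.ofFinite _
  ends f := G.ends f.1
  no_loops f := G.no_loops f.1

/-- An edge of `G` is removable if `G - e` is matching covered. -/
noncomputable def Removable (e : G.E) : Prop := (G.deleteEdge e).MatchingCovered

/-- The graph obtained by deleting a set of vertices (and all incident edges). -/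
noncomputable def deleteVerts (S : Set G.V) : Multigraph where
  V := {v : G.V // v ∉ S}
  E := {e : G.E // ∀ v ∈ G.ends e, v ∉ S}
  fintV := Fintype.ofFinite _
  fintE := Fintype.ofFinite _
  ends e := (G.ends e.1).attachWith e.2
  no_loops e h := G.no_loops e.1 (by
    have := (Sym2.isDiag_map Subtype.val_injective).mpr h
    simpa using this)

/-- Two-connectedness: at least three vertices, and deleting any vertex
leaves a connected graph. -/
noncomputable def TwoConnected : Prop :=
  3 ≤ Nat.card G.V ∧ ∀ v : G.V, (G.deleteVerts {v}).Connected

/-- Three-connectedness: at least four vertices, and deleting any two distinct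
vertices leaves a connected graph. -/
noncomputable def ThreeConnected : Prop :=
  4 ≤ Nat.card G.V ∧ ∀ u v : G.V, u ≠ v → (G.deleteVerts {u, v}).Connected

/-- The cut `∂(X)`: edges with exactly one end in `X`. -/
def cut (X : Set G.V) : Set G.E :=
  {e | ∃ u ∈ X, ∃ w ∈ Xᶜ, G.ends e = s(u, w)}

/-- A tight cut: a cut (with both shores nonempty) met by every perfect matching
in exactly one edge. -/
def IsTightCut (X : Set G.V) : Prop :=
  X.Nonempty ∧ Xᶜ.Nonempty ∧
    ∀ M : Set G.E, G.IsPerfectMatching M → ∃! e, e ∈ M ∧ e ∈ G.cut X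

/-- A cut `∂(X)` is trivial if one of its shores is a singleton. -/
def TrivialShore (X : Set G.V) : Prop := (∃ v, X = {v}) ∨ (∃ v, Xᶜ = {v})

/-- `G` is bipartite. -/
def Bipartite : Prop :=
  ∃ c : G.V → Bool, ∀ (e : G.E) (a b : G.V), G.ends e = s(a, b) → c a ≠ c b

/-- The subgraph of `G` induced by `X` is bipartite. -/
def BipartiteOn (X : Set G.V) : Prop :=
  ∃ c : G.V → Bool, ∀ (e : G.E) (a b : G.V),
    G.ends e = s(a, b) → a ∈ X → b ∈ X → c a ≠ c b

lemma Sym2.exists_eq_mk {α : Type*} (z : Sym2 α) : ∃ a b, z = s(a, b) := by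
  induction z using Sym2.ind with
  | _ x y => exact ⟨x, y, rfl⟩

open Classical in
/-- Contraction `G/X`: the shore `X` is shrunk to a single new vertex.
Edges with both ends in `X` disappear. -/
noncomputable def contract (X : Set G.V) : Multigraph where
  V := {v : G.V // v ∉ X} ⊕ Unit
  E := {e : G.E // ¬ ∀ v ∈ G.ends e, v ∈ X}
  fintV := Fintype.ofFinite _
  fintE := Fintype.ofFinite _
  ends e := (G.ends e.1).map
    (fun v => if h : v ∈ X then Sum.inr () else Sum.inl ⟨v, h⟩)
  no_loops := by
    rintro ⟨e, he⟩ hdiag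
    obtain ⟨a, b, hab⟩ := Sym2.exists_eq_mk (G.ends e)
    have hne : a ≠ b := by
      have := G.no_loops e
      rw [hab, Sym2.mk_isDiag_iff] at this
      exact this
    simp only [hab, Sym2.map_pair_eq, Sym2.mk_isDiag_iff] at hdiag
    by_cases ha : a ∈ X <;> by_cases hb : b ∈ X
    · exact he (by
        rw [hab]; intro v hv
        rcases Sym2.mem_iff.mp hv with h | h <;> subst h <;> assumption)
    · rw [dif_pos ha, dif_neg hb] at hdiag; simp at hdiag
    · rw [dif_neg ha, dif_pos hb] at hdiag; simp at hdiag
    · rw [dif_neg ha, dif_neg hb] at hdiag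
      simp only [Sum.inl.injEq, Subtype.mk.injEq] at hdiag
      exact hne hdiag

/-- A brick: a nonbipartite matching covered graph all of whose tight cuts are
trivial. -/
def IsBrick : Prop :=
  G.MatchingCovered ∧ ¬ G.Bipartite ∧ ∀ X : Set G.V, G.IsTightCut X → G.TrivialShore X

/-- A brace: a bipartite matching covered graph all of whose tight cuts are
trivial. -/
def IsBrace : Prop :=
  G.MatchingCovered ∧ G.Bipartite ∧ ∀ X : Set G.V, G.IsTightCut X → G.TrivialShore X

/-- `BrickCount G n` holds if some tight cut decomposition of `G` produces
exactly `n` bricks.  (By Lovász's theorem the number `n` is independent of the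
decomposition.) -/
inductive BrickCount : (G : Multigraph) → ℕ → Prop
  | brick (G : Multigraph) (h : G.IsBrick) : BrickCount G 1
  | brace (G : Multigraph) (h : G.IsBrace) : BrickCount G 0
  | cut (G : Multigraph) (X : Set G.V) (ht : G.IsTightCut X) (hnt : ¬ G.TrivialShore X)
      {n m : ℕ} (h1 : BrickCount (G.contract X) n) (h2 : BrickCount (G.contract Xᶜ) m) :
      BrickCount G (n + m)

/-- A near-brick: a matching covered graph whose tight cut decompositions
have exactly one brick. -/
def IsNearBrick : Prop := G.MatchingCovered ∧ BrickCount G 1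

/-- A single ear of length at least 3: an odd path of length `k ≥ 3` all of whose
internal vertices have degree two. -/
def HasLongSingleEar : Prop :=
  ∃ (k : ℕ) (v : Fin (k + 1) → G.V) (e : Fin k → G.E),
    Odd k ∧ 3 ≤ k ∧ Function.Injective v ∧ Function.Injective e ∧
    (∀ i : Fin k, G.ends (e i) = s(v i.castSucc, v i.succ)) ∧
    (∀ i : Fin (k + 1), i ≠ 0 → i ≠ Fin.last k → G.degree (v i) = 2)

/-- Irreducible: no single ear of length three or more. -/
def Irreducible : Prop := ¬ G.HasLongSingleEar

/-- Isomorphism of multigraphs. -/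
def IsIso (G H : Multigraph) : Prop :=
  ∃ (φ : G.V ≃ H.V) (ψ : G.E ≃ H.E), ∀ e, H.ends (ψ e) = (G.ends e).map φ

end Multigraph

open Multigraph

/-- The complete graph `K₂`. -/
def K2 : Multigraph where
  V := Fin 2
  E := Unit
  ends _ := s(0, 1)
  no_loops _ := by simp [Sym2.mk_isDiag_iff]

/-- The complete graph `K₄`. -/
noncomputable def K4 : Multigraph where
  V := Fin 4
  E := {p : Sym2 (Fin 4) // ¬ p.IsDiag}
  fintE := Fintype.ofFinite _
  ends p := p.1
  no_loops p := p.2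

/-- The cycle `C₄`. -/
def C4 : Multigraph where
  V := ZMod 4
  E := ZMod 4
  ends i := s(i, i + 1)
  no_loops i := by
    have h : ∀ j : ZMod 4, j ≠ j + 1 := by decide
    simpa [Sym2.mk_isDiag_iff] using h i

/-- `C̄₆`, the complement of the 6-cycle (the triangular prism). -/
noncomputable def C6bar : Multigraph where
  V := ZMod 6
  E := {p : Sym2 (ZMod 6) // ¬ p.IsDiag ∧ ∀ a b : ZMod 6, p = s(a, b) → b ≠ a + 1 ∧ a ≠ b + 1}
  fintE := Fintype.ofFinite _
  ends p := p.1
  no_loops p := p.2.1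

namespace Multigraph

variable {G : Multigraph}

/-- A perfect matching, presented by the matching edge and the partner of every vertex. -/
structure PM (G : Multigraph) where
  edge : G.V → G.E
  mate : G.V → G.V
  ends_edge : ∀ v, G.ends (edge v) = s(v, mate v)
  edge_mate : ∀ v, edge (mate v) = edge v

theorem ne_of_ends {g : G.E} {u w : G.V} (h : G.ends g = s(u, w)) : u ≠ w := by
  rintro rfl
  exact G.no_loops g (by rw [h]; simp)

theorem exists_ends (g : G.E) : ∃ u w, G.ends g = s(u, w) := Sym2.exists_eq_mk _

theorem exists_ends_of_mem {g : G.E} {u : G.V} (h : u ∈ G.ends g) :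
    ∃ w, G.ends g = s(u, w) := by
  obtain ⟨w, hw⟩ := h
  exact ⟨w, hw⟩

namespace PM

variable (P : PM G)

theorem mate_ne (v : G.V) : P.mate v ≠ v := (ne_of_ends (P.ends_edge v)).symm

@[simp] theorem mate_mate (v : G.V) : P.mate (P.mate v) = v := by
  have h := P.ends_edge (P.mate v)
  rw [P.edge_mate, P.ends_edge, Sym2.eq_iff] at h
  rcases h with ⟨h, -⟩ | ⟨h, -⟩
  · exact absurd h.symm (P.mate_ne v)
  · exact h.symm

theorem mate_injective : Function.Injective P.mate :=
  Function.LeftInverse.injective P.mate_mate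

theorem mem_ends (v : G.V) : v ∈ G.ends (P.edge v) := by simp [P.ends_edge]

/-- The edge `e` belongs to the matching. -/
def Has (e : G.E) : Prop := ∃ v, P.edge v = e

theorem has_edge (v : G.V) : P.Has (P.edge v) := ⟨v, rfl⟩

variable {P}

theorem Has.edge_eq {e : G.E} (h : P.Has e) {u : G.V} (hu : u ∈ G.ends e) : P.edge u = e := by
  obtain ⟨v, rfl⟩ := h
  rw [P.ends_edge, Sym2.mem_iff] at hu
  rcases hu with rfl | rfl
  · rfl
  · exact P.edge_mate v

theorem Has.mate_eq {e : G.E} (h : P.Has e) {u w : G.V} (hu : G.ends e = s(u, w)) :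
    P.mate u = w := by
  have h1 := P.ends_edge u
  rw [h.edge_eq (by simp [hu]), hu] at h1
  exact (Sym2.congr_right.1 h1).symm

theorem Has.eq_of_mem {e f : G.E} (he : P.Has e) (hf : P.Has f) {v : G.V}
    (h1 : v ∈ G.ends e) (h2 : v ∈ G.ends f) : e = f := by
  rw [← he.edge_eq h1, hf.edge_eq h2]

/-- A perfect matching from a choice of an edge at every vertex. -/
noncomputable def ofMap (ν : G.V → G.E) (h1 : ∀ v, v ∈ G.ends (ν v))
    (h2 : ∀ v w, w ∈ G.ends (ν v) → ν w = ν v) : PM G where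
  edge := ν
  mate v := (exists_ends_of_mem (h1 v)).choose
  ends_edge v := (exists_ends_of_mem (h1 v)).choose_spec
  edge_mate v := h2 v _
    (Sym2.mem_iff_exists.2 ⟨v, (exists_ends_of_mem (h1 v)).choose_spec.trans Sym2.eq_swap⟩)

@[simp] theorem ofMap_edge (ν : G.V → G.E) (h1 : ∀ v, v ∈ G.ends (ν v))
    (h2 : ∀ v w, w ∈ G.ends (ν v) → ν w = ν v) : (ofMap ν h1 h2).edge = ν := rfl

end PM

theorem IsPerfectMatching.exists_pm {M : Set G.E} (hM : G.IsPerfectMatching M) :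
    ∃ P : PM G, ∀ e, P.Has e ↔ e ∈ M := by
  choose ν h1 h2 using hM
  refine ⟨PM.ofMap ν (fun v => (h1 v).2) fun v w hw => (h2 w _ ⟨(h1 v).1, hw⟩).symm, fun e => ?_⟩
  constructor
  · rintro ⟨v, rfl⟩
    exact (h1 v).1
  · intro he
    obtain ⟨u, w, huw⟩ := exists_ends e
    exact ⟨u, (h2 u e ⟨he, by simp [Inc, huw]⟩).symm⟩

theorem MatchingCovered.exists_pm (hG : G.MatchingCovered) (e : G.E) : ∃ P : PM G, P.Has e := by
  obtain ⟨M, hM, he⟩ := hG.2.2 e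
  obtain ⟨P, hP⟩ := hM.exists_pm
  exact ⟨P, (hP e).2 he⟩

theorem Connected.mem_of_closed (hG : G.Connected) {X : Set G.V} {x : G.V} (hx : x ∈ X)
    (h : ∀ g u w, G.ends g = s(u, w) → u ∈ X → w ∈ X) (v : G.V) : v ∈ X := by
  induction hG.2 x v with
  | refl => exact hx
  | tail _ hbc ih =>
    obtain ⟨-, g, hg⟩ := hbc
    exact h g _ _ hg ih

theorem even_card_of_involution {α : Type*} (X : Finset α) (m : α → α)
    (hm : ∀ v, m (m v) = v) (hne : ∀ v, m v ≠ v) (hX : ∀ v ∈ X, m v ∈ X) : Even X.card := by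
  have : ∑ _v ∈ X, (1 : ZMod 2) = 0 :=
    Finset.sum_involution (fun v _ => m v) (fun _ _ => by decide) (fun v _ _ => hne v)
      (fun v hv => hX v hv) fun v _ => hm v
  rw [Finset.sum_const, nsmul_eq_mul, mul_one] at this
  exact (ZMod.natCast_eq_zero_iff_even).1 this

open Classical in
theorem even_card_iff_exits {α : Type*} (X : Finset α) (m : α → α)
    (hm : ∀ v, m (m v) = v) (hne : ∀ v, m v ≠ v) :
    Even X.card ↔ Even (X.filter fun v => m v ∉ X).card := by
  have h := even_card_of_involution (X.filter fun v => m v ∈ X) m hm hne (by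
    intro v hv
    simp only [Finset.mem_filter] at hv ⊢
    exact ⟨hv.2, by rw [hm]; exact hv.1⟩)
  rw [← Finset.card_filter_add_card_filter_not (s := X) (fun v => m v ∈ X), Nat.even_add]
  tauto

theorem IsBrick.false_of_tight (hG : G.IsBrick) {X : Set G.V} (hX : X.Nontrivial)
    (hXc : Xᶜ.Nontrivial) (h : ∀ P : PM G, ∃! v, v ∈ X ∧ P.mate v ∉ X) : False := by
  have ht : G.IsTightCut X := by
    refine ⟨hX.nonempty, hXc.nonempty, fun M hM => ?_⟩
    obtain ⟨P, hP⟩ := hM.exists_pm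
    obtain ⟨v, ⟨hv, hv'⟩, huniq⟩ := h P
    refine ⟨P.edge v, ⟨(hP _).1 (P.has_edge v), v, hv, _, hv', P.ends_edge v⟩, ?_⟩
    rintro e ⟨he, u, hu, w, hw, huw⟩
    have he := (hP e).2 he
    rw [← huniq u ⟨hu, by rw [he.mate_eq huw]; exact hw⟩]
    exact (he.edge_eq (by simp [huw])).symm
  rcases hG.2.2 X ht with ⟨v, rfl⟩ | ⟨v, hv⟩
  · simp at hX
  · rw [hv] at hXc; simp at hXc

/-- Every perfect matching through `e` contains `f`. -/
def Dep (e f : G.E) : Prop := ∀ P : PM G, P.Has e → P.Has f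

theorem exists_odd_sets_of_not_isPerfectMatching {α : Type*} [Fintype α] (H : SimpleGraph α)
    (h : ∀ M : H.Subgraph, ¬ M.IsPerfectMatching) (heven : Even (Nat.card α)) :
    ∃ (S : Finset α) (𝒦 : Finset (Finset α)), S.card + 2 ≤ 𝒦.card ∧
      (∀ K ∈ 𝒦, Odd K.card ∧ Disjoint K S) ∧ (𝒦 : Set (Finset α)).PairwiseDisjoint id ∧
      ∀ K ∈ 𝒦, ∀ u ∈ K, ∀ w, H.Adj u w → w ∈ K ∨ w ∈ S := by
  classical
  have h0 := mt (SimpleGraph.tutte (G := H)).2 (by simpa using h)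
  push Not at h0
  obtain ⟨S, hS⟩ := h0
  unfold SimpleGraph.IsTutteViolator at hS
  set D := ((⊤ : H.Subgraph).deleteVerts S).coe with hD
  have hpar := D.odd_ncard_oddComponents
  have hcardV : Nat.card ((⊤ : H.Subgraph).deleteVerts S).verts + S.ncard = Nat.card α := by
    have hv : ((⊤ : H.Subgraph).deleteVerts S).verts = Sᶜ := by
      ext v; simp
    rw [hv, Nat.card_coe_set_eq, add_comm, Set.ncard_add_ncard_compl]
  let F : D.ConnectedComponent → Finset α := fun c => (Subtype.val '' c.supp).toFinset
  have hF : ∀ c v, v ∈ F c ↔ ∃ h, D.connectedComponentMk ⟨v, h⟩ = c := by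
    intro c v
    simp only [F, Set.mem_toFinset, Set.mem_image, SimpleGraph.ConnectedComponent.mem_supp_iff]
    constructor
    · rintro ⟨⟨x, hx⟩, h, rfl⟩
      exact ⟨hx, h⟩
    · rintro ⟨h, hc⟩
      exact ⟨⟨v, h⟩, hc, rfl⟩
  have hdisj : ∀ c d v, v ∈ F c → v ∈ F d → c = d := by
    intro c d v hc hd
    obtain ⟨h1, rfl⟩ := (hF _ _).1 hc
    obtain ⟨h2, rfl⟩ := (hF _ _).1 hd
    rfl
  have hne : ∀ c, (F c).Nonempty := by
    intro c
    obtain ⟨v, hv⟩ := c.nonempty_supp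
    exact ⟨v.1, (hF _ _).2 ⟨v.2, hv⟩⟩
  have hinj : Function.Injective F := by
    intro c d hcd
    obtain ⟨v, hv⟩ := hne c
    exact hdisj c d v hv (hcd ▸ hv)
  refine ⟨S.toFinset, D.oddComponents.toFinset.image F, ?_, ?_, ?_, ?_⟩
  · rw [Finset.card_image_of_injective _ hinj, ← Set.ncard_eq_toFinset_card',
      ← Set.ncard_eq_toFinset_card']
    rcases Nat.lt_or_ge (S.ncard + 1) D.oddComponents.ncard with h1 | h1
    · omega
    · have : D.oddComponents.ncard = S.ncard + 1 := le_antisymm h1 hS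
      rw [this] at hpar
      exfalso
      grind
  · intro K hK
    simp only [Finset.mem_image, Set.mem_toFinset] at hK
    obtain ⟨c, hc, rfl⟩ := hK
    constructor
    · rw [← Set.ncard_eq_toFinset_card', Set.ncard_image_of_injective _ Subtype.val_injective]
      exact hc
    · rw [Finset.disjoint_left]
      intro v hv hvS
      obtain ⟨h1, -⟩ := (hF _ _).1 hv
      simp at h1 hvS
      exact h1 hvS
  · intro K hK L hL hKL
    simp only [Finset.coe_image, Set.coe_toFinset, Set.mem_image] at hK hL
    obtain ⟨c, hc, rfl⟩ := hK
    obtain ⟨d, hd, rfl⟩ := hL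
    rw [Function.onFun, id, id, Finset.disjoint_left]
    intro v hv hv'
    exact hKL (by rw [hdisj c d v hv hv'])
  · intro K hK u hu w huw
    simp only [Finset.mem_image, Set.mem_toFinset] at hK
    obtain ⟨c, hc, rfl⟩ := hK
    obtain ⟨h1, rfl⟩ := (hF _ _).1 hu
    by_cases hw : w ∈ S
    · right; simpa using hw
    · left
      have h2 : w ∈ ((⊤ : H.Subgraph).deleteVerts S).verts := by simpa using hw
      refine (hF _ _).2 ⟨h2, ?_⟩
      rw [SimpleGraph.ConnectedComponent.eq]
      apply SimpleGraph.Adj.reachable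
      simp at h1 hw
      simp [hD, h1, hw, huw.symm]

theorem existsUnique_exit_of_card_le {α : Type*} {m : α → α} (hm : ∀ v, m (m v) = v)
    (hne : ∀ v, m v ≠ v) {B : Finset α} {𝒦 : Finset (Finset α)} (hcard : B.card ≤ 𝒦.card)
    (hodd : ∀ K ∈ 𝒦, Odd K.card) (hpd : (𝒦 : Set (Finset α)).PairwiseDisjoint id)
    (hB : ∀ K ∈ 𝒦, ∀ v ∈ K, m v ∉ K → m v ∈ B) :
    (∀ K ∈ 𝒦, ∃! v, v ∈ K ∧ m v ∉ K) ∧ ∀ b ∈ B, ∃ K ∈ 𝒦, m b ∈ K := by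
  classical
  obtain rfl | ⟨K', hK'⟩ := 𝒦.eq_empty_or_nonempty
  · simp_all
  have : Nonempty α := (Finset.card_pos.1 (hodd K' hK').pos).to_type
  have hex : ∀ K ∈ 𝒦, ∃ v, v ∈ K ∧ m v ∉ K := by
    intro K hK
    by_contra! h
    exact Nat.not_even_iff_odd.2 (hodd K hK) (even_card_of_involution K m hm hne h)
  choose! g hg using hex
  have heq : ∀ K ∈ 𝒦, ∀ L ∈ 𝒦, ∀ v, v ∈ K → v ∈ L → K = L := by
    intro K hK L hL v h1 h2
    by_contra hKL
    exact Finset.disjoint_left.1 (hpd hK hL hKL) h1 h2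
  have hsurj : Set.SurjOn (fun K => m (g K)) 𝒦 B := by
    refine Finset.surjOn_of_injOn_of_card_le _ (fun K hK => ?_) ?_ hcard
    · exact hB K hK _ (hg K hK).1 (hg K hK).2
    · intro K hK L hL hKL
      have h : g K = g L := by rw [← hm (g K), ← hm (g L)]; exact congrArg m hKL
      exact heq K hK L hL _ (hg K hK).1 (h ▸ (hg L hL).1)
  refine ⟨fun K hK => ⟨g K, hg K hK, ?_⟩, fun b hb => ?_⟩
  · rintro v ⟨hv, hv'⟩
    obtain ⟨L, hL, hLv⟩ := hsurj (hB K hK v hv hv')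
    have h : g L = v := by rw [← hm (g L), ← hm v]; exact congrArg m hLv
    rw [← h, heq K hK L hL _ hv (h ▸ (hg L hL).1)]
  · obtain ⟨K, hK, rfl⟩ := hsurj hb
    exact ⟨K, hK, by rw [hm]; exact (hg K hK).1⟩

theorem Dep.exists_barrier {e f : G.E} (hdep : Dep e f) (hne : e ≠ f) {P₀ : PM G}
    (hP₀ : P₀.Has e) {x y : G.V} (he : G.ends e = s(x, y)) :
    ∃ (B : Finset G.V) (𝒦 : Finset (Finset G.V)), x ∈ B ∧ y ∈ B ∧ B.card ≤ 𝒦.card ∧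
      (∀ K ∈ 𝒦, Odd K.card ∧ Disjoint K B) ∧ (𝒦 : Set (Finset G.V)).PairwiseDisjoint id ∧
      ∀ K ∈ 𝒦, ∀ u ∈ K, ∀ w g, g ≠ f → G.ends g = s(u, w) → w ∈ K ∨ w ∈ B := by
  classical
  let T := {v : G.V // v ≠ x ∧ v ≠ y}
  let H : SimpleGraph T :=
    { Adj := fun u w => ∃ g, g ≠ f ∧ G.ends g = s(u.1, w.1)
      symm := ⟨fun u w ⟨g, h1, h2⟩ => ⟨g, h1, h2.trans Sym2.eq_swap⟩⟩
      loopless := ⟨fun u ⟨g, _, h2⟩ => ne_of_ends h2 rfl⟩ }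
  have hγ : ∀ z : Sym2 T, ∃ g : G.E, z ∈ H.edgeSet → g ≠ f ∧ G.ends g = z.map Subtype.val := by
    intro z
    by_cases hz : z ∈ H.edgeSet
    · induction z with
      | h u w =>
        obtain ⟨g, h1, h2⟩ := hz
        exact ⟨g, fun _ => ⟨h1, by simp [h2]⟩⟩
    · exact ⟨e, fun h => absurd h hz⟩
  choose γ hγ using hγ
  have hnoPM : ∀ M : H.Subgraph, ¬ M.IsPerfectMatching := by
    intro M hM
    rw [SimpleGraph.Subgraph.isPerfectMatching_iff] at hM
    choose m hm hm' using hM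
    have hadj : ∀ u, s(u, m u) ∈ H.edgeSet := fun u => M.adj_sub (hm u)
    have hmm : ∀ u, m (m u) = u := fun u => (hm' _ _ (hm u).symm).symm
    let ν : G.V → G.E := fun v => if h : v ≠ x ∧ v ≠ y then γ s(⟨v, h⟩, m ⟨v, h⟩) else e
    have hends : ∀ v (h : v ≠ x ∧ v ≠ y), G.ends (ν v) = s(v, (m ⟨v, h⟩).1) := by
      intro v h
      simp only [ν, dif_pos h]
      rw [(hγ _ (hadj _)).2]
      rfl
    have hends' : ∀ v, ¬ (v ≠ x ∧ v ≠ y) → ν v = e := fun v h => by simp only [ν, dif_neg h]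
    let P : PM G := PM.ofMap ν
      (by
        intro v
        by_cases h : v ≠ x ∧ v ≠ y
        · simp [hends v h]
        · rw [hends' v h, he, Sym2.mem_iff]
          tauto)
      (by
        intro v w hw
        by_cases h : v ≠ x ∧ v ≠ y
        · rw [hends v h, Sym2.mem_iff] at hw
          rcases hw with rfl | rfl
          · rfl
          · simp only [ν, dif_pos h, dif_pos (m ⟨v, h⟩).2, Subtype.coe_eta, hmm]
            rw [Sym2.eq_swap]
        · rw [hends' v h, he, Sym2.mem_iff] at hw
          rw [hends' v h, hends' w (by tauto)])
    obtain ⟨v, hv⟩ := hdep P ⟨x, hends' x (by simp)⟩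
    change ν v = f at hv
    by_cases h : v ≠ x ∧ v ≠ y
    · simp only [ν, dif_pos h] at hv
      exact (hγ _ (hadj _)).1 hv
    · rw [hends' v h] at hv
      exact hne hv
  have heven : Even (Nat.card T) := by
    rw [Nat.card_eq_fintype_card, Fintype.card_subtype]
    refine even_card_of_involution _ P₀.mate P₀.mate_mate P₀.mate_ne fun v hv => ?_
    have h1 := hP₀.mate_eq he
    have h2 : P₀.mate y = x := by rw [← h1, P₀.mate_mate]
    simp only [Finset.mem_filter, Finset.mem_univ, true_and] at hv ⊢
    constructor
    · intro h
      exact hv.2 (by rw [← P₀.mate_mate v, h, h1])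
    · intro h
      exact hv.1 (by rw [← P₀.mate_mate v, h, h2])
  obtain ⟨S, 𝒦, hcard, hodd, hpd, hadj⟩ :=
    exists_odd_sets_of_not_isPerfectMatching H hnoPM heven
  have hmem : ∀ (K : Finset T) (u : G.V),
      u ∈ K.map (.subtype _) ↔ ∃ h : u ≠ x ∧ u ≠ y, (⟨u, h⟩ : T) ∈ K := by
    intro K u
    simp [T]
  refine ⟨insert x (insert y (S.map (.subtype _))),
    𝒦.map (Finset.mapEmbedding (.subtype _)).toEmbedding, by simp, by simp, ?_, ?_, ?_, ?_⟩
  · rw [Finset.card_map]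
    refine (Finset.card_insert_le _ _).trans ((Nat.succ_le_succ (Finset.card_insert_le _ _)).trans ?_)
    rw [Finset.card_map]
    exact hcard
  · simp only [Finset.mem_map, forall_exists_index, and_imp]
    rintro _ K hK rfl
    refine ⟨by simpa using (hodd K hK).1, ?_⟩
    rw [Finset.disjoint_left]
    intro v hv hv'
    obtain ⟨h1, h2⟩ := (hmem K v).1 hv
    simp only [Finset.mem_insert, h1.1, h1.2, false_or] at hv'
    obtain ⟨h3, h4⟩ := (hmem S v).1 hv'
    exact Finset.disjoint_left.1 (hodd K hK).2 h2 h4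
  · intro K hK L hL hKL
    simp only [Finset.coe_map, Set.mem_image] at hK hL
    obtain ⟨K, hK, rfl⟩ := hK
    obtain ⟨L, hL, rfl⟩ := hL
    rw [Function.onFun, id, id, Finset.disjoint_left]
    intro v hv hv'
    obtain ⟨h1, h2⟩ := (hmem K v).1 hv
    obtain ⟨h3, h4⟩ := (hmem L v).1 hv'
    refine Finset.disjoint_left.1 (hpd hK hL ?_) h2 h4
    rintro rfl
    exact hKL rfl
  · simp only [Finset.mem_map, forall_exists_index, and_imp]
    rintro _ K hK rfl u hu w g hg hgu
    obtain ⟨h1, h2⟩ := (hmem K u).1 hu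
    by_cases hw : w ≠ x ∧ w ≠ y
    · rcases hadj K hK _ h2 ⟨w, hw⟩ ⟨g, hg, hgu⟩ with h | h
      · exact Or.inl ((hmem K w).2 ⟨hw, h⟩)
      · right
        simp only [Finset.mem_insert]
        exact Or.inr (Or.inr ((hmem S w).2 ⟨hw, h⟩))
    · right
      simp only [Finset.mem_insert]
      tauto

theorem IsBrick.exists_bipartition (hG : G.IsBrick) {e f : G.E} (hne : e ≠ f) (hef : Dep e f)
    (hfe : Dep f e) : ∃ a : G.V → Bool, (∀ v ∈ G.ends e, a v = true) ∧
      (∀ v ∈ G.ends f, a v = false) ∧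
      ∀ g u w, G.ends g = s(u, w) → g ≠ e → g ≠ f → a u ≠ a w := by
  classical
  obtain ⟨P₀, hP₀⟩ := hG.1.exists_pm e
  obtain ⟨x, y, he⟩ := exists_ends e
  obtain ⟨p, q, hf⟩ := exists_ends f
  have hxy := ne_of_ends he
  have hpq := ne_of_ends hf
  have hdisj : ∀ v, v ∈ G.ends e → v ∉ G.ends f := fun v h1 h2 =>
    hne (hP₀.eq_of_mem (hef _ hP₀) h1 h2)
  simp only [he, hf, Sym2.mem_iff] at hdisj
  have hxp : x ≠ p := fun h => hdisj x (.inl rfl) (.inl h)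
  have hxq : x ≠ q := fun h => hdisj x (.inl rfl) (.inr h)
  have hyp : y ≠ p := fun h => hdisj y (.inr rfl) (.inl h)
  have hyq : y ≠ q := fun h => hdisj y (.inr rfl) (.inr h)
  obtain ⟨B, 𝒦, hxB, hyB, hcard, hodd, hpd, hadj⟩ := hef.exists_barrier hne hP₀ he
  have heq : ∀ K ∈ 𝒦, ∀ L ∈ 𝒦, ∀ v, v ∈ K → v ∈ L → K = L := by
    intro K hK L hL v h1 h2
    by_contra hKL
    exact Finset.disjoint_left.1 (hpd hK hL hKL) h1 h2
  have hnB : ∀ K ∈ 𝒦, ∀ v ∈ K, v ∉ B := fun K hK v hv => Finset.disjoint_left.1 (hodd K hK).2 hv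
  have key : ∀ P : PM G, (∀ K ∈ 𝒦, ∃! v, v ∈ K ∧ P.mate v ∉ K) ∧
      (∀ b ∈ B, P.edge b = e ∨ ∃ K ∈ 𝒦, P.mate b ∈ K) ∧
      (P.Has e → (∃ K ∈ 𝒦, p ∈ K) ∧ ∃ K ∈ 𝒦, q ∈ K) := by
    intro P
    by_cases hPe : P.Has e
    · have hPf := hef P hPe
      have hx := hPe.mate_eq he
      have hy : P.mate y = x := by rw [← hx, P.mate_mate]
      have hp := hPf.mate_eq hf
      have hq : P.mate q = p := by rw [← hp, P.mate_mate]
      let m : G.V → G.V := fun v =>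
        if v = x then p else if v = p then x else if v = y then q else if v = q then y else P.mate v
      have hmx : m x = p := by simp [m]
      have hmp : m p = x := by simp [m, hxp.symm]
      have hmy : m y = q := by simp [m, hxy.symm, hyp]
      have hmq : m q = y := by simp [m, hxq.symm, hpq.symm, hyq.symm]
      have hm0 : ∀ v, v ≠ x → v ≠ p → v ≠ y → v ≠ q → m v = P.mate v := by
        intro v h1 h2 h3 h4; simp [m, h1, h2, h3, h4]
      have hmm : ∀ v, m (m v) = v := by
        intro v
        by_cases h1 : v = x
        · rw [h1, hmx, hmp]
        by_cases h2 : v = p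
        · rw [h2, hmp, hmx]
        by_cases h3 : v = y
        · rw [h3, hmy, hmq]
        by_cases h4 : v = q
        · rw [h4, hmq, hmy]
        have := P.mate_mate v
        rw [hm0 v h1 h2 h3 h4, hm0 _, this] <;> rintro h <;> rw [h] at this <;> grind
      have hmne : ∀ v, m v ≠ v := by
        intro v
        have := P.mate_ne v
        simp only [m]
        split_ifs <;> grind
      have hex : ∀ K ∈ 𝒦, ∀ v ∈ K, m v ∉ K → m v ∈ B := by
        intro K hK v hv hmv
        by_cases h1 : v = x
        · exact absurd (h1 ▸ hxB) (hnB K hK v hv)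
        by_cases h2 : v = p
        · rw [h2, hmp]; exact hxB
        by_cases h3 : v = y
        · exact absurd (h3 ▸ hyB) (hnB K hK v hv)
        by_cases h4 : v = q
        · rw [h4, hmq]; exact hyB
        rw [hm0 v h1 h2 h3 h4] at hmv ⊢
        refine (hadj K hK v hv _ (P.edge v) ?_ (P.ends_edge v)).resolve_left hmv
        intro h
        have := P.mem_ends v
        rw [h, hf, Sym2.mem_iff] at this
        tauto
      obtain ⟨h1, h2⟩ := existsUnique_exit_of_card_le hmm hmne hcard (fun K hK => (hodd K hK).1)
        hpd hex
      have hpK := h2 x hxB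
      have hqK := h2 y hyB
      rw [hmx] at hpK
      rw [hmy] at hqK
      have hiff : ∀ K ∈ 𝒦, ∀ v, (v ∈ K ∧ P.mate v ∉ K) ↔ v ∈ K ∧ m v ∉ K := by
        intro K hK v
        have hxK : x ∉ K := fun h => hnB K hK x h hxB
        have hyK : y ∉ K := fun h => hnB K hK y h hyB
        have hpqK : ¬ (p ∈ K ∧ q ∈ K) := by
          rintro ⟨hpK, hqK⟩
          exact hpq ((h1 K hK).unique ⟨hpK, hmp ▸ hxK⟩ ⟨hqK, hmq ▸ hyK⟩)
        by_cases h1 : v = x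
        · simp [h1, hxK]
        by_cases h3 : v = y
        · simp [h3, hyK]
        by_cases h2 : v = p
        · rw [h2, hmp, hp]; tauto
        by_cases h4 : v = q
        · rw [h4, hmq, hq]; tauto
        rw [hm0 v h1 h2 h3 h4]
      refine ⟨fun K hK => ?_, fun b hb => ?_, fun _ => ⟨hpK, hqK⟩⟩
      · simpa only [hiff K hK] using h1 K hK
      · by_cases hbx : b = x
        · left; exact hPe.edge_eq (by simp [hbx, he])
        by_cases hby : b = y
        · left; exact hPe.edge_eq (by simp [hby, he])
        right
        have hbp : b ≠ p := by
          rintro rfl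
          obtain ⟨K, hK, h⟩ := hpK
          exact hnB K hK _ h hb
        have hbq : b ≠ q := by
          rintro rfl
          obtain ⟨K, hK, h⟩ := hqK
          exact hnB K hK _ h hb
        rw [← hm0 b hbx hbp hby hbq]
        exact h2 b hb
    · obtain ⟨h1, h2⟩ := existsUnique_exit_of_card_le P.mate_mate P.mate_ne hcard
        (fun K hK => (hodd K hK).1) hpd (fun K hK v hv hmv =>
          (hadj K hK v hv _ (P.edge v) (fun h => hPe (hfe P ⟨v, h⟩)) (P.ends_edge v)).resolve_left
            hmv)
      exact ⟨h1, fun b hb => Or.inr (h2 b hb), fun h => absurd h hPe⟩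
  obtain ⟨⟨Kp, hKp, hpK⟩, ⟨Kq, hKq, hqK⟩⟩ := (key P₀).2.2 hP₀
  have hcover : ∀ v, v ∈ B ∨ ∃ K ∈ 𝒦, v ∈ K := by
    refine hG.1.2.1.mem_of_closed (X := {v | v ∈ B ∨ ∃ K ∈ 𝒦, v ∈ K}) (Or.inl hxB) ?_
    intro g u w hg hu
    obtain ⟨P, hPg⟩ := hG.1.exists_pm g
    rcases hu with hu | ⟨K, hK, hu⟩
    · rcases (key P).2.1 u hu with h | h
      · have h3 : g = e := by rw [← h, hPg.edge_eq (by simp [hg])]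
        have h4 : w ∈ G.ends e := by rw [← h3, hg]; simp
        rw [he, Sym2.mem_iff] at h4
        rcases h4 with rfl | rfl
        · exact Or.inl hxB
        · exact Or.inl hyB
      · rw [hPg.mate_eq hg] at h
        exact Or.inr h
    · by_cases hgf : g = f
      · have h4 : w ∈ G.ends f := by rw [← hgf, hg]; simp
        rw [hf, Sym2.mem_iff] at h4
        rcases h4 with rfl | rfl
        · exact Or.inr ⟨Kp, hKp, hpK⟩
        · exact Or.inr ⟨Kq, hKq, hqK⟩
      · rcases hadj K hK u hu w g hgf hg with h | h
        · exact Or.inr ⟨K, hK, h⟩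
        · exact Or.inl h
  have hsingle : ∀ K ∈ 𝒦, ∀ u ∈ K, ∀ v ∈ K, u = v := by
    intro K hK u hu v hv
    by_contra huv
    exact hG.false_of_tight (X := K) ⟨u, hu, v, hv, huv⟩
      ⟨x, fun h => hnB K hK x h hxB, y, fun h => hnB K hK y h hyB, hxy⟩ fun P => (key P).1 K hK
  refine ⟨fun v => decide (v ∈ B), ?_, ?_, ?_⟩
  · intro v hv
    rw [he, Sym2.mem_iff] at hv
    rcases hv with rfl | rfl <;> simpa
  · intro v hv
    rw [hf, Sym2.mem_iff] at hv
    rcases hv with rfl | rfl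
    · simpa using hnB _ hKp _ hpK
    · simpa using hnB _ hKq _ hqK
  · intro g u w hg hge hgf
    have huw := ne_of_ends hg
    by_cases hu : u ∈ B
    · obtain ⟨P, hPg⟩ := hG.1.exists_pm g
      rcases (key P).2.1 u hu with h | ⟨K, hK, h⟩
      · exact absurd (by rw [← h, hPg.edge_eq (by simp [hg])]) hge
      · rw [hPg.mate_eq hg] at h
        simp [hu, hnB K hK w h]
    · obtain ⟨K, hK, huK⟩ := (hcover u).resolve_left hu
      rcases hadj K hK u huK w g hgf hg with h | h
      · exact absurd (hsingle K hK u huK w h) huw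
      · simp [hu, h]

theorem Dep.refl (e : G.E) : Dep e e := fun _ h => h

theorem Dep.trans {e f g : G.E} (h1 : Dep e f) (h2 : Dep f g) : Dep e g :=
  fun P h => h2 P (h1 P h)

theorem exists_minimal_dep (g : G.E) :
    ∃ f, Dep f g ∧ ∀ h : G.E, Dep h f → Dep f h := by
  classical
  obtain ⟨f, hf, hmin⟩ := Finset.exists_min_image (Finset.univ.filter fun f : G.E => Dep f g)
    (fun f => (Finset.univ.filter fun h : G.E => Dep h f).card) ⟨g, by simp [Dep.refl]⟩
  simp only [Finset.mem_filter, Finset.mem_univ, true_and] at hf hmin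
  refine ⟨f, hf, fun h hh => ?_⟩
  have hsub : (Finset.univ.filter fun k : G.E => Dep k h) ⊆
      Finset.univ.filter fun k : G.E => Dep k f := by
    intro k hk
    simp only [Finset.mem_filter, Finset.mem_univ, true_and] at hk ⊢
    exact hk.trans hh
  have := Finset.eq_of_subset_of_card_le hsub (hmin h (hh.trans hf))
  have hff : f ∈ Finset.univ.filter fun k : G.E => Dep k f := by simp [Dep.refl]
  rw [← this] at hff
  simpa using hff

theorem deleteEdge_connected (hG : G.MatchingCovered) {f : G.E}
    (h : ∀ h ≠ f, ∃ P : PM G, P.Has h ∧ ¬ P.Has f) (hex : ∃ h : G.E, h ≠ f) :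
    (G.deleteEdge f).Connected := by
  classical
  refine ⟨hG.2.1.1, fun u v => ?_⟩
  let X : Set G.V := {w | Relation.ReflTransGen (G.deleteEdge f).Adj u w}
  change v ∈ X
  have hX : ∀ g ≠ f, ∀ a b, G.ends g = s(a, b) → a ∈ X → b ∈ X := by
    intro g hg a b hab ha
    exact Relation.ReflTransGen.tail ha ⟨ne_of_ends hab, ⟨g, hg⟩, hab⟩
  refine hG.2.1.mem_of_closed (X := X) (x := u) .refl ?_ v
  intro g a b hab ha
  by_cases hg : g = f
  · subst hg
    by_contra hb
    obtain ⟨h₁, hh₁⟩ := hex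
    obtain ⟨P, -, hP⟩ := h h₁ hh₁
    obtain ⟨Q, hQ⟩ := hG.exists_pm g
    have h1 : Even X.toFinset.card := by
      refine even_card_of_involution _ P.mate P.mate_mate P.mate_ne fun w hw => ?_
      simp only [Set.mem_toFinset] at hw ⊢
      exact hX (P.edge w) (fun h => hP ⟨w, h⟩) _ _ (P.ends_edge w) hw
    rw [even_card_iff_exits _ Q.mate Q.mate_mate Q.mate_ne] at h1
    have h2 : (X.toFinset.filter fun w => Q.mate w ∉ X.toFinset) = {a} := by
      ext w
      simp only [Finset.mem_filter, Set.mem_toFinset, Finset.mem_singleton]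
      constructor
      · rintro ⟨hw, hw'⟩
        by_contra hwa
        refine hw' (hX (Q.edge w) ?_ _ _ (Q.ends_edge w) hw)
        intro h
        have := Q.mem_ends w
        rw [h, hab, Sym2.mem_iff] at this
        rcases this with h | h
        · exact hwa h
        · exact hb (h ▸ hw)
      · rintro rfl
        exact ⟨ha, by rwa [hQ.mate_eq hab]⟩
    rw [h2] at h1
    simp at h1
  · exact hX g hg a b hab ha

theorem IsBrick.exists_dep_of_not_removable (hG : G.IsBrick) {f : G.E} (hf : ¬ G.Removable f) :
    ∃ h, h ≠ f ∧ Dep h f := by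
  classical
  by_contra! hcon
  have hcon' : ∀ h ≠ f, ∃ P : PM G, P.Has h ∧ ¬ P.Has f := by
    intro h hh
    have := hcon h hh
    unfold Dep at this
    push Not at this
    exact this
  have hex : ∃ h : G.E, h ≠ f := by
    by_contra! h
    obtain ⟨x, y, hxy⟩ := exists_ends f
    refine hG.2.1 ⟨fun v => decide (v = x), fun e a b hab => ?_⟩
    rw [h e, hxy, Sym2.eq_iff] at hab
    have := ne_of_ends hxy
    rcases hab with ⟨rfl, rfl⟩ | ⟨rfl, rfl⟩ <;> simp [this.symm]
  refine hf ⟨hG.1.1, deleteEdge_connected hG.1 hcon' hex, fun h => ?_⟩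
  obtain ⟨P, hPh, hPf⟩ := hcon' h.1 h.2
  refine ⟨{g | P.Has g.1}, fun v => ?_, hPh⟩
  exact ⟨⟨P.edge v, fun h => hPf ⟨v, h⟩⟩, ⟨P.has_edge v, P.mem_ends v⟩,
    fun g hg => Subtype.ext (hg.1.edge_eq hg.2).symm⟩

/-- Three pairs `{r i true, r i false}` of edges such that deleting each pair leaves a graph
bipartite with colouring `a i`; every perfect matching contains both or neither
edge of a pair, and meets at most one of the pairs. -/
structure Config (G : Multigraph) where
  a : Fin 3 → G.V → Bool
  r : Fin 3 → Bool → G.E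
  mono : ∀ i b v, v ∈ G.ends (r i b) → a i v = b
  flip : ∀ i g u w, G.ends g = s(u, w) → (∀ b, g ≠ r i b) → a i w = !a i u
  pair : ∀ (P : PM G) i b, P.Has (r i b) → P.Has (r i !b)
  excl : ∀ (P : PM G) i j b d, P.Has (r i b) → P.Has (r j d) → i = j

theorem fin_three_cases (i j : Fin 3) : j = i ∨ j = i + 1 ∨ j = i + 2 := by
  revert i j; decide

theorem fin_three_add_one_ne (i : Fin 3) : i + 1 ≠ i := by
  revert i; decide

theorem fin_three_add_two_ne (i : Fin 3) : i + 2 ≠ i := by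
  revert i; decide

namespace Config

/-- Change of the colourings by a sign vector. -/
def shift (c : Config G) (t : Fin 3 → Bool) : Config G where
  a i v := xor (c.a i v) (t i)
  r i b := c.r i (xor b (t i))
  mono i b v h := by rw [c.mono i _ v h]; simp
  flip i g u w h hg := by
    rw [c.flip i g u w h fun b => by simpa using hg (xor b (t i))]
    simp
  pair P i b h := by simpa using c.pair P i _ h
  excl P i j b d h1 h2 := c.excl P i j _ _ h1 h2

variable (c : Config G)

/-- Some end of the edge `r i b`. -/
noncomputable def endpoint (i : Fin 3) (b : Bool) : G.V := (exists_ends (c.r i b)).choose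

theorem endpoint_mem (i : Fin 3) (b : Bool) : c.endpoint i b ∈ G.ends (c.r i b) := by
  obtain ⟨w, hw⟩ := (exists_ends (c.r i b)).choose_spec
  exact Sym2.mem_iff_exists.2 ⟨w, hw⟩

/-- The sign of `r i b` : whether the two other colourings disagree on its ends. -/
noncomputable def sign (i : Fin 3) (b : Bool) : Bool :=
  xor (c.a (i + 1) (c.endpoint i b)) (c.a (i + 2) (c.endpoint i b))

/-- The vertices on which the three colourings agree. -/
def core : Set G.V := {v | ∀ i j, c.a i v = c.a j v}

variable {c}

theorem mem_core_iff (i : Fin 3) {v : G.V} :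
    v ∈ c.core ↔ c.a (i + 1) v = c.a i v ∧ c.a (i + 2) v = c.a i v := by
  constructor
  · intro h
    exact ⟨h _ _, h _ _⟩
  · rintro ⟨h1, h2⟩ j k
    have key : ∀ j, c.a j v = c.a i v := by
      intro j
      rcases fin_three_cases i j with rfl | rfl | rfl <;> simp_all
    rw [key j, key k]

theorem ends_r {u w : G.V} {i : Fin 3} {b : Bool} (h : G.ends (c.r i b) = s(u, w)) :
    c.a i u = b ∧ c.a i w = b :=
  ⟨c.mono i b u (by simp [h]), c.mono i b w (by simp [h])⟩

theorem r_injective (hG : G.MatchingCovered) {i j : Fin 3} {b d : Bool}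
    (h : c.r i b = c.r j d) : i = j ∧ b = d := by
  obtain ⟨P, hP⟩ := hG.exists_pm (c.r i b)
  obtain rfl := c.excl P i j b d hP (h ▸ hP)
  refine ⟨rfl, ?_⟩
  rw [← c.mono i b _ (c.endpoint_mem i b)]
  exact c.mono i d _ (h ▸ c.endpoint_mem i b)

theorem flip_r (hG : G.MatchingCovered) {u w : G.V} {i j : Fin 3} {b : Bool} (hij : j ≠ i)
    (h : G.ends (c.r i b) = s(u, w)) : c.a j w = !c.a j u :=
  c.flip j _ u w h fun _ h' => hij (r_injective hG h').1.symm

theorem sign_eq (hG : G.MatchingCovered) {i : Fin 3} {b : Bool} {v : G.V}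
    (hv : v ∈ G.ends (c.r i b)) : xor (c.a (i + 1) v) (c.a (i + 2) v) = c.sign i b := by
  obtain ⟨w, hw⟩ := exists_ends_of_mem hv
  have h1 := flip_r hG (fin_three_add_one_ne i) hw
  have h2 := flip_r hG (fin_three_add_two_ne i) hw
  have h3 := c.endpoint_mem i b
  rw [hw, Sym2.mem_iff] at h3
  unfold sign
  rcases h3 with h3 | h3
  · rw [h3]
  · rw [h3, h1, h2]; simp

/-- The end of `r i b` at which the colouring `i + 1` has the value `b`. -/
theorem exists_ends_r (hG : G.MatchingCovered) (c : Config G) (i : Fin 3) (b : Bool) :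
    ∃ v w, G.ends (c.r i b) = s(v, w) ∧
      c.a i v = b ∧ c.a (i + 1) v = b ∧ c.a (i + 2) v = xor b (c.sign i b) ∧
      c.a i w = b ∧ c.a (i + 1) w = !b ∧ c.a (i + 2) w = !xor b (c.sign i b) := by
  have key : ∀ v w, G.ends (c.r i b) = s(v, w) → c.a (i + 1) v = b → c.a i v = b ∧
      c.a (i + 1) v = b ∧ c.a (i + 2) v = xor b (c.sign i b) ∧
      c.a i w = b ∧ c.a (i + 1) w = !b ∧ c.a (i + 2) w = !xor b (c.sign i b) := by
    intro v w h hv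
    have h1 := flip_r hG (fin_three_add_one_ne i) h
    have h2 := flip_r hG (fin_three_add_two_ne i) h
    have h3 := ends_r h
    have h4 := sign_eq hG (c := c) (v := v) (i := i) (b := b) (by simp [h])
    grind
  obtain ⟨v, w, h⟩ := exists_ends (c.r i b)
  by_cases hv : c.a (i + 1) v = b
  · exact ⟨v, w, h, key v w h hv⟩
  · have h' : G.ends (c.r i b) = s(w, v) := h.trans Sym2.eq_swap
    refine ⟨w, v, h', key w v h' ?_⟩
    have h1 := flip_r hG (fin_three_add_one_ne i) h
    grind

theorem sign_shift (hG : G.MatchingCovered) (t : Fin 3 → Bool) (i : Fin 3) (b : Bool) :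
    (c.shift t).sign i b = xor (c.sign i (xor b (t i))) (xor (t (i + 1)) (t (i + 2))) := by
  obtain ⟨v, w, h⟩ := exists_ends ((c.shift t).r i b)
  rw [← sign_eq hG (v := v) (by simp [h]), ← sign_eq hG (c := c) (v := v) (i := i)
    (by rw [show G.ends (c.r i (xor b (t i))) = s(v, w) from h]; simp)]
  simp only [shift]
  cases c.a (i + 1) v <;> cases c.a (i + 2) v <;> cases t (i + 1) <;> cases t (i + 2) <;> rfl

theorem sign_of_mem_core (hG : G.MatchingCovered) {v : G.V} (hv : v ∈ c.core) {i : Fin 3}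
    {b : Bool} (h : v ∈ G.ends (c.r i b)) : c.sign i b = false := by
  rw [← sign_eq hG h, hv (i + 1) (i + 2)]
  simp

theorem eq_of_mem_core (hG : G.MatchingCovered) {v w : G.V} (hv : v ∈ c.core) (hw : w ∈ c.core)
    {i : Fin 3} {b : Bool} (h : v ∈ G.ends (c.r i b)) (h' : w ∈ G.ends (c.r i b)) : v = w := by
  obtain ⟨u, hu⟩ := exists_ends_of_mem h
  rw [hu, Sym2.mem_iff] at h'
  rcases h' with rfl | rfl
  · rfl
  · exfalso
    have h1 := flip_r hG (fin_three_add_one_ne i) hu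
    have h2 := ends_r hu
    have h3 := hv i (i + 1)
    have h4 := hw i (i + 1)
    grind

theorem mem_core_of_ends {g : G.E} {u w : G.V} (h : G.ends g = s(u, w))
    (hg : ∀ i b, g ≠ c.r i b) (hu : u ∈ c.core) : w ∈ c.core := by
  intro i j
  rw [c.flip i g u w h (hg i), c.flip j g u w h (hg j), hu i j]

theorem exit_core_iff (hG : G.MatchingCovered) (P : PM G) (v : G.V) :
    (v ∈ c.core ∧ P.mate v ∉ c.core) ↔ v ∈ c.core ∧ ∃ i b, P.edge v = c.r i b := by
  refine and_congr_right fun hv => ⟨fun h => ?_, ?_⟩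
  · by_contra! h'
    exact h (mem_core_of_ends (P.ends_edge v) h' hv)
  · rintro ⟨i, b, h⟩ h'
    refine P.mate_ne v (eq_of_mem_core hG h' hv (i := i) (b := b) ?_ ?_) <;>
      simp [← h, P.ends_edge]

theorem exists_mem_core (hG : G.MatchingCovered) {i : Fin 3} {b : Bool}
    (h : c.sign i b = false) : ∃ v ∈ c.core, v ∈ G.ends (c.r i b) := by
  obtain ⟨v, w, h1, h2, h3, h4, -⟩ := exists_ends_r hG c i b
  refine ⟨v, (mem_core_iff i).2 ?_, by simp [h1]⟩
  rw [h2, h3, h4, h]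
  simp

open Classical in
theorem even_card_core_iff (hG : G.MatchingCovered) (i : Fin 3) :
    Even c.core.toFinset.card ↔ c.sign i true = c.sign i false := by
  obtain ⟨P, hP⟩ := hG.exists_pm (c.r i true)
  have hP' := c.pair P i _ hP
  rw [even_card_iff_exits _ P.mate P.mate_mate P.mate_ne]
  have hX : ∀ v, v ∈ (c.core.toFinset.filter fun v => P.mate v ∉ c.core.toFinset) ↔
      v ∈ c.core ∧ (v ∈ G.ends (c.r i true) ∨ v ∈ G.ends (c.r i false)) := by
    intro v
    simp only [Finset.mem_filter, Set.mem_toFinset, exit_core_iff hG]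
    refine and_congr_right fun hv => ⟨?_, ?_⟩
    · rintro ⟨j, b, h⟩
      obtain rfl := c.excl P i j _ _ hP ⟨v, h⟩
      have := P.mem_ends v
      rw [h] at this
      cases b
      · exact Or.inr this
      · exact Or.inl this
    · rintro (h | h)
      · exact ⟨i, _, hP.edge_eq h⟩
      · exact ⟨i, _, hP'.edge_eq h⟩
  generalize (c.core.toFinset.filter fun v => P.mate v ∉ c.core.toFinset) = X at hX
  rcases ht : c.sign i true <;> rcases hf : c.sign i false
  · obtain ⟨v, hv, hv'⟩ := exists_mem_core hG ht
    obtain ⟨w, hw, hw'⟩ := exists_mem_core hG hf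
    have hvw : v ≠ w := by
      rintro rfl
      have h1 := c.mono _ _ _ hv'
      rw [c.mono _ _ _ hw'] at h1
      simp at h1
    have : X = {v, w} := by
      ext u
      rw [hX, Finset.mem_insert, Finset.mem_singleton]
      constructor
      · rintro ⟨hu, h | h⟩
        · exact Or.inl (eq_of_mem_core hG hu hv h hv')
        · exact Or.inr (eq_of_mem_core hG hu hw h hw')
      · rintro (rfl | rfl)
        · exact ⟨hv, Or.inl hv'⟩
        · exact ⟨hw, Or.inr hw'⟩
    simp [this, Finset.card_pair hvw]
  · obtain ⟨v, hv, hv'⟩ := exists_mem_core hG ht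
    have : X = {v} := by
      ext u
      rw [hX, Finset.mem_singleton]
      constructor
      · rintro ⟨hu, h | h⟩
        · exact eq_of_mem_core hG hu hv h hv'
        · simp [sign_of_mem_core hG hu h] at hf
      · rintro rfl
        exact ⟨hv, Or.inl hv'⟩
    simp [this]
  · obtain ⟨v, hv, hv'⟩ := exists_mem_core hG hf
    have : X = {v} := by
      ext u
      rw [hX, Finset.mem_singleton]
      constructor
      · rintro ⟨hu, h | h⟩
        · simp [sign_of_mem_core hG hu h] at ht
        · exact eq_of_mem_core hG hu hv h hv'
      · rintro rfl
        exact ⟨hv, Or.inr hv'⟩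
    simp [this]
  · have : X = ∅ := by
      ext u
      rw [hX]
      simp only [Finset.notMem_empty, iff_false, not_and, not_or]
      refine fun hu => ⟨fun h => ?_, fun h => ?_⟩
      · simp [sign_of_mem_core hG hu h] at ht
      · simp [sign_of_mem_core hG hu h] at hf
    simp [this]

end Config
theorem isIso_of_simple {G H : Multigraph} (φ : G.V ≃ H.V) (hGi : Function.Injective G.ends)
    (hHi : Function.Injective H.ends)
    (h : ∀ u w, (∃ e, G.ends e = s(u, w)) ↔ ∃ e, H.ends e = s(φ u, φ w)) : IsIso G H := by
  have h1 : ∀ e : G.E, ∃ e' : H.E, H.ends e' = (G.ends e).map φ := by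
    intro e
    obtain ⟨u, w, he⟩ := exists_ends e
    obtain ⟨e', he'⟩ := (h u w).1 ⟨e, he⟩
    exact ⟨e', by rw [he', he]; rfl⟩
  choose ψ hψ using h1
  have hbij : Function.Bijective ψ := by
    constructor
    · intro e e' hee
      apply hGi
      apply Sym2.map.injective φ.injective
      rw [← hψ, ← hψ, hee]
    · intro e'
      obtain ⟨u, w, he'⟩ := exists_ends e'
      obtain ⟨e, he⟩ := (h (φ.symm u) (φ.symm w)).2 ⟨e', by simpa using he'⟩
      refine ⟨e, hHi ?_⟩
      rw [hψ, he, he']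
      simp
  exact ⟨φ, Equiv.ofBijective ψ hbij, fun e => by simpa using hψ e⟩

namespace Config

variable {c : Config G}

theorem sign_ne_of_sign_ne (hG : G.MatchingCovered) {i : Fin 3}
    (h : c.sign i true ≠ c.sign i false) (j : Fin 3) : c.sign j true ≠ c.sign j false := by
  rw [Ne, ← even_card_core_iff hG] at h ⊢
  exact h

theorem sign_ne_shift (hG : G.MatchingCovered) (h : ∀ i, c.sign i true ≠ c.sign i false)
    (t : Fin 3 → Bool) (i : Fin 3) :
    (c.shift t).sign i true ≠ (c.shift t).sign i false := by
  rw [sign_shift hG, sign_shift hG]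
  have := h i
  cases t i <;> grind

theorem core_nonempty (hG : G.MatchingCovered) (h : ∀ i, c.sign i true ≠ c.sign i false) :
    c.core.Nonempty := by
  have : ∃ b, c.sign 0 b = false := by
    have := h 0
    cases h1 : c.sign 0 true
    · exact ⟨_, h1⟩
    · exact ⟨false, by grind⟩
  obtain ⟨b, hb⟩ := this
  obtain ⟨v, hv, -⟩ := exists_mem_core hG hb
  exact ⟨v, hv⟩

theorem core_subsingleton (hG : G.IsBrick) (h : ∀ i, c.sign i true ≠ c.sign i false) :
    c.core.Subsingleton := by
  classical
  rw [← Set.not_nontrivial_iff]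
  intro hX
  refine hG.false_of_tight hX ?_ fun P => ?_
  · obtain ⟨u, hu⟩ := core_nonempty hG.1 (sign_ne_shift hG.1 h fun j => decide (j = 0))
    obtain ⟨w, hw⟩ := core_nonempty hG.1 (sign_ne_shift hG.1 h fun j => decide (j = 1))
    have hu0 := hu 0 1
    have hu1 := hu 1 2
    have hw0 := hw 0 1
    have hw1 := hw 0 2
    simp only [shift] at hu0 hu1 hw0 hw1
    refine ⟨u, fun h => ?_, w, fun h => ?_, ?_⟩
    · have := h 0 1
      simp_all
    · have := h 0 1
      simp_all
    · rintro rfl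
      simp_all
  · have hodd : Odd c.core.toFinset.card := by
      rw [← Nat.not_even_iff_odd, even_card_core_iff hG.1 0]
      exact h 0
    rw [← Nat.not_even_iff_odd, even_card_iff_exits _ P.mate P.mate_mate P.mate_ne,
      Nat.not_even_iff_odd] at hodd
    obtain ⟨v, hv⟩ := Finset.card_pos.1 hodd.pos
    simp only [Finset.mem_filter, Set.mem_toFinset] at hv
    refine ⟨v, hv, fun w hw => ?_⟩
    obtain ⟨hv, i, b, hib⟩ := (exit_core_iff hG.1 P v).1 hv
    obtain ⟨hw, j, d, hjd⟩ := (exit_core_iff hG.1 P w).1 hw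
    obtain rfl := c.excl P i j b d ⟨v, hib⟩ ⟨w, hjd⟩
    have hv' : v ∈ G.ends (c.r i b) := by rw [← hib]; exact P.mem_ends v
    have hw' : w ∈ G.ends (c.r i d) := by rw [← hjd]; exact P.mem_ends w
    have h1 := sign_of_mem_core hG.1 hv hv'
    have h2 := sign_of_mem_core hG.1 hw hw'
    have hbd : b = d := by
      have := h i
      cases b <;> cases d <;> simp_all
    subst hbd
    exact eq_of_mem_core hG.1 hw hv hw' hv'

theorem eq_of_class_eq (hG : G.IsBrick) (h : ∀ i, c.sign i true ≠ c.sign i false) (i : Fin 3)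
    {u w : G.V} (h1 : xor (c.a i u) (c.a (i + 1) u) = xor (c.a i w) (c.a (i + 1) w))
    (h2 : xor (c.a (i + 1) u) (c.a (i + 2) u) = xor (c.a (i + 1) w) (c.a (i + 2) w)) :
    u = w := by
  refine core_subsingleton hG (sign_ne_shift hG.1 h fun j => c.a j u) ?_ ?_
  · intro j k
    simp [shift]
  · rw [mem_core_iff i]
    simp only [shift]
    revert h1 h2
    cases c.a i u <;> cases c.a (i + 1) u <;> cases c.a (i + 2) u <;> cases c.a i w <;>
      cases c.a (i + 1) w <;> cases c.a (i + 2) w <;> decide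

theorem isIso_K4 (hG : G.IsBrick) (h : ∀ i, c.sign i true ≠ c.sign i false) : IsIso G K4 := by
  classical
  have hedge : ∀ g, ∃ i b, g = c.r i b := by
    intro g
    by_contra! hg
    obtain ⟨u, w, huw⟩ := exists_ends g
    refine ne_of_ends huw (eq_of_class_eq hG h 0 ?_ ?_) <;>
      rw [c.flip _ g u w huw (hg _), c.flip _ g u w huw (hg _)] <;> simp
  have hadj : ∀ u w, u ≠ w → ∃ g, G.ends g = s(u, w) := by
    intro u w huw
    have hi : ∃ i : Fin 3, xor (c.a (i + 1) u) (c.a (i + 2) u) =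
        xor (c.a (i + 1) w) (c.a (i + 2) w) := by
      by_contra! hcon
      have h0 := hcon 0
      have h1 := hcon 1
      have h2 := hcon 2
      have e1 : (1 : Fin 3) + 1 = 2 := rfl
      have e2 : (1 : Fin 3) + 2 = 0 := rfl
      have e3 : (2 : Fin 3) + 1 = 0 := rfl
      have e4 : (2 : Fin 3) + 2 = 1 := rfl
      simp only [zero_add, e1, e2, e3, e4] at h0 h1 h2
      revert h0 h1 h2
      cases c.a 0 u <;> cases c.a 1 u <;> cases c.a 2 u <;> cases c.a 0 w <;>
        cases c.a 1 w <;> cases c.a 2 w <;> decide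
    obtain ⟨i, hi⟩ := hi
    have hd : xor (c.a i u) (c.a (i + 1) u) ≠ xor (c.a i w) (c.a (i + 1) w) :=
      fun h' => huw (eq_of_class_eq hG h i h' hi)
    have hb : ∃ b, c.sign i b = xor (c.a (i + 1) u) (c.a (i + 2) u) := by
      have := h i
      by_cases hT : c.sign i true = xor (c.a (i + 1) u) (c.a (i + 2) u)
      · exact ⟨_, hT⟩
      · exact ⟨false, by grind⟩
    obtain ⟨b, hb⟩ := hb
    obtain ⟨v, x, hvx, a1, a2, a3, a4, a5, a6⟩ := exists_ends_r hG.1 c i b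
    refine ⟨c.r i b, hvx.trans ?_⟩
    by_cases huv : xor (c.a i u) (c.a (i + 1) u) = false
    · rw [eq_of_class_eq hG h i (u := v) (w := u) (by grind) (by grind),
        eq_of_class_eq hG h i (u := x) (w := w) (by grind) (by grind)]
    · rw [eq_of_class_eq hG h i (u := v) (w := w) (by grind) (by grind),
        eq_of_class_eq hG h i (u := x) (w := u) (by grind) (by grind)]
      exact Sym2.eq_swap
  have hcard : Fintype.card G.V = Fintype.card (Fin 4) := by
    rw [show Fintype.card (Fin 4) = Fintype.card (Bool × Bool) by simp]
    refine Fintype.card_of_bijective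
      (f := fun v => (xor (c.a 0 v) (c.a (0 + 1) v), xor (c.a (0 + 1) v) (c.a (0 + 2) v))) ⟨?_, ?_⟩
    · intro u w huw
      simp only [Prod.mk.injEq] at huw
      exact eq_of_class_eq hG h 0 huw.1 huw.2
    · rintro ⟨p, q⟩
      obtain ⟨v, hv⟩ := core_nonempty hG.1 (sign_ne_shift hG.1 h
        fun j => if j = 0 then p else if j = 1 then false else q)
      refine ⟨v, ?_⟩
      have h1 := hv 0 1
      have h2 := hv 1 2
      simp [shift] at h1 h2
      simp only [zero_add, Prod.mk.injEq]
      revert h1 h2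
      cases c.a 0 v <;> cases c.a 1 v <;> cases c.a 2 v <;> cases p <;> cases q <;> decide
  let φ : G.V ≃ K4.V := Fintype.equivOfCardEq hcard
  refine isIso_of_simple φ ?_ Subtype.val_injective ?_
  · intro g g' hgg
    obtain ⟨i, b, rfl⟩ := hedge g
    obtain ⟨j, d, rfl⟩ := hedge g'
    obtain ⟨u, w, huw⟩ := exists_ends (c.r i b)
    have huw' := hgg ▸ huw
    have hij : i = j := by
      by_contra hij
      have h1 := flip_r hG.1 (Ne.symm hij) huw
      have h2 := ends_r huw'
      grind
    subst hij
    rw [← (ends_r huw).1, ← (ends_r huw').1]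
  · intro u w
    constructor
    · rintro ⟨e, he⟩
      exact ⟨⟨s(_, _), fun h => ne_of_ends he (φ.injective (Sym2.mk_isDiag_iff.1 h))⟩, rfl⟩
    · rintro ⟨e, he⟩
      refine hadj u w fun huw => e.2 ?_
      change e.1 = _ at he
      rw [he, huw]
      exact Sym2.mk_isDiag_iff.2 rfl

theorem false_of_star (hG : G.IsBrick) (h : ∀ i b, c.sign i b = false) : False := by
  obtain ⟨x, x', hx, x0, x1, x2, x3, x4, x5⟩ := exists_ends_r hG.1 c 0 true
  obtain ⟨y, y', hy, y0, y1, y2, y3, y4, y5⟩ := exists_ends_r hG.1 c 0 false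
  rw [h] at x2 x5 y2 y5
  simp only [zero_add, Bool.xor_false, Bool.not_true, Bool.not_false] at x0 x1 x2 x3 x4 x5 y0 y1 y2 y3 y4 y5
  let d := c.shift fun j => decide (j = 0)
  have hsign : ∀ i b, d.sign i b = decide (i ≠ 0) := by
    intro i b
    rw [sign_shift hG.1, h]
    revert i; decide
  have hmem : ∀ v, v ∈ d.core ↔ c.a 1 v = (!c.a 0 v) ∧ c.a 2 v = !c.a 0 v := by
    intro v
    rw [mem_core_iff 0]
    simp [d, shift]
  have hr : ∀ v ∈ d.core, ∀ P : PM G, P.mate v ∉ d.core → ∃ b, P.edge v = c.r 0 b := by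
    intro v hv P hP
    obtain ⟨-, i, b, hib⟩ := (exit_core_iff hG.1 P v).1 ⟨hv, hP⟩
    have h1 := sign_of_mem_core hG.1 hv (i := i) (b := b) (by rw [← hib]; exact P.mem_ends v)
    rw [hsign] at h1
    have h2 : i = 0 := by simpa using h1
    subst h2
    exact ⟨_, hib⟩
  have hxd : x ∉ d.core := by rw [hmem]; simp [x0, x1]
  have hyd : y ∉ d.core := by rw [hmem]; simp [y0, y1]
  have hxd' : x' ∈ d.core := by rw [hmem]; simp [x3, x4, x5]
  have hyd' : y' ∈ d.core := by rw [hmem]; simp [y3, y4, y5]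
  refine hG.false_of_tight (X := insert x d.core) ⟨x, by simp, x', by simp [hxd'], ne_of_ends hx⟩
    ?_ fun P => ?_
  · obtain ⟨w, w', hw, w0, w1, w2, w3, w4, w5⟩ := exists_ends_r hG.1 c 1 true
    obtain ⟨z, z', hz, z0, z1, z2, z3, z4, z5⟩ := exists_ends_r hG.1 c 1 false
    have e1 : (1 : Fin 3) + 1 = 2 := rfl
    have e2 : (1 : Fin 3) + 2 = 0 := rfl
    rw [h] at w5 z5
    simp only [e1, e2, Bool.xor_false, Bool.not_true, Bool.not_false] at w3 w4 w5 z3 z4 z5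
    refine ⟨w', ?_, z', ?_, ?_⟩
    · rw [Set.mem_compl_iff, Set.mem_insert_iff, hmem]
      rintro (rfl | h) <;> simp_all
    · rw [Set.mem_compl_iff, Set.mem_insert_iff, hmem]
      rintro (rfl | h) <;> simp_all
    · rintro rfl
      simp_all
  · by_cases hP : P.Has (c.r 0 true)
    · have hP' := c.pair P 0 _ hP
      refine ⟨y', ⟨by simp [hyd'], ?_⟩, ?_⟩
      · rw [hP'.mate_eq (hy.trans Sym2.eq_swap), Set.mem_insert_iff, not_or]
        refine ⟨?_, hyd⟩
        rintro rfl
        simp_all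
      · rintro v ⟨hv | hv, hv'⟩
        · rw [hv, hP.mate_eq hx] at hv'
          simp [hxd'] at hv'
        · rw [Set.mem_insert_iff, not_or] at hv'
          obtain ⟨b, hb⟩ := hr v hv P hv'.2
          have h1 := P.mem_ends v
          rw [hb] at h1
          cases b
          · rw [hy, Sym2.mem_iff] at h1
            rcases h1 with rfl | rfl
            · exact absurd hv hyd
            · rfl
          · rw [hx, Sym2.mem_iff] at h1
            rcases h1 with rfl | rfl
            · exact absurd hv hxd
            · exact absurd (hP.mate_eq (hx.trans Sym2.eq_swap)) hv'.1
    · have hnr : ∀ v b, P.edge v ≠ c.r 0 b := by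
        intro v b hb
        cases b
        · exact hP (c.pair P 0 _ ⟨v, hb⟩)
        · exact hP ⟨v, hb⟩
      have hd : ∀ v ∈ d.core, P.mate v ∈ d.core := by
        intro v hv
        by_contra hv'
        obtain ⟨b, hb⟩ := hr v hv P hv'
        exact hnr v b hb
      refine ⟨x, ⟨by simp, ?_⟩, ?_⟩
      · rw [Set.mem_insert_iff, not_or]
        refine ⟨P.mate_ne x, fun h' => hxd ?_⟩
        rw [← P.mate_mate x]
        exact hd _ h'
      · rintro v ⟨hv | hv, hv'⟩
        · exact hv
        · exact absurd (Or.inr (hd v hv)) hv'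

end Config
theorem PM.exists_glue (P Q : PM G) {X Y : Set G.V} (hX : ∀ v ∈ X, P.mate v ∈ X)
    (hY : ∀ v ∈ Y, Q.mate v ∈ Y) (hXY : ∀ v ∈ X, v ∉ Y) (μ : G.V → G.E)
    (hμ : ∀ v, v ∉ X → v ∉ Y → v ∈ G.ends (μ v) ∧
      ∀ w ∈ G.ends (μ v), w ∉ X ∧ w ∉ Y ∧ μ w = μ v) :
    ∃ R : PM G, (∀ v ∈ X, R.edge v = P.edge v) ∧ ∀ v ∈ Y, R.edge v = Q.edge v := by
  classical
  refine ⟨PM.ofMap (fun v => if v ∈ X then P.edge v else if v ∈ Y then Q.edge v else μ v)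
    ?_ ?_, ?_, ?_⟩
  · intro v
    split_ifs with h1 h2
    · exact P.mem_ends v
    · exact Q.mem_ends v
    · exact (hμ v h1 h2).1
  · intro v w
    split_ifs with h1 h2 h3 h4 h5 h6 h7 h8
    · intro hw
      exact (P.has_edge v).edge_eq hw
    · intro hw
      rw [P.ends_edge, Sym2.mem_iff] at hw
      rcases hw with rfl | rfl
      · exact absurd h1 h2
      · exact absurd (hX v h1) h2
    all_goals grind [PM.ends_edge, PM.edge_mate]
  · intro v hv
    simp [hv]
  · intro v hv
    have : v ∉ X := fun h => hXY v h hv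
    simp [hv, this]

theorem IsBrick.false_of_card_eq_add_one (hG : G.IsBrick) {S N : Finset G.V}
    (hcard : N.card = S.card + 1) (hS : ∀ P : PM G, ∀ v ∈ S, P.mate v ∈ N)
    (hN : ∀ P : PM G, ∀ v ∈ N, P.mate v ∉ N) (hNn : (N : Set G.V).Nontrivial)
    (hc : {v | v ∉ S ∧ v ∉ N}.Nontrivial) : False := by
  classical
  refine hG.false_of_tight (X := {v | v ∈ S ∨ v ∈ N}) (hNn.mono fun v hv => Or.inr hv)
    (hc.mono fun v hv => by simpa using hv) fun P => ?_
  have hsub : S.image P.mate ⊆ N := by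
    intro w hw
    obtain ⟨v, hv, rfl⟩ := Finset.mem_image.1 hw
    exact hS P v hv
  have h1 : (N \ S.image P.mate).card = 1 := by
    rw [Finset.card_sdiff_of_subset hsub, Finset.card_image_of_injective _ P.mate_injective]
    omega
  obtain ⟨n, hn⟩ := Finset.card_eq_one.1 h1
  have hmem : ∀ v, v ∈ N ∧ P.mate v ∉ S ↔ v = n := by
    intro v
    rw [← Finset.mem_singleton, ← hn, Finset.mem_sdiff, Finset.mem_image]
    refine and_congr_right fun _ => not_congr ⟨fun h => ⟨_, h, P.mate_mate v⟩, ?_⟩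
    rintro ⟨u, hu, rfl⟩
    simpa using hu
  refine ⟨n, ?_, ?_⟩
  · obtain ⟨h2, h3⟩ := (hmem n).2 rfl
    exact ⟨Or.inr h2, fun h => h.elim h3 (hN P n h2)⟩
  · rintro v ⟨hv | hv, hv'⟩
    · exact absurd (Or.inr (hS P v hv)) hv'
    · exact (hmem v).1 ⟨hv, fun h => hv' (Or.inl h)⟩

theorem fin_three_eq_or {i j k : Fin 3} (hij : i ≠ j) (hik : i ≠ k) (hjk : j ≠ k) (l : Fin 3) :
    l = i ∨ l = j ∨ l = k := by
  revert i j k l; decide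

namespace Config

/-- The vertices at which exactly the colouring `k` disagrees with the common value `b` of
the two others. -/
def side (c : Config G) (k : Fin 3) (b : Bool) : Set G.V :=
  {v | c.a k v = (!b) ∧ ∀ j ≠ k, c.a j v = b}

variable {c : Config G}

theorem notMem_core (hG : G.MatchingCovered) (h : ∀ i b, c.sign i b = true) (v : G.V) :
    v ∉ c.core := by
  intro hv
  have hall : ∀ u, u ∈ c.core := by
    refine hG.2.1.mem_of_closed hv fun g u w hg hu => mem_core_of_ends hg ?_ hu
    rintro i b rfl
    have := sign_of_mem_core hG hu (i := i) (b := b) (by simp [hg])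
    simp [h] at this
  obtain ⟨u, w, hg⟩ := exists_ends (c.r 0 true)
  exact ne_of_ends hg (eq_of_mem_core hG (hall u) (hall w) (i := 0) (b := true) (by simp [hg])
    (by simp [hg]))

theorem exists_mem_side (hG : G.MatchingCovered) (h : ∀ i b, c.sign i b = true) (v : G.V) :
    ∃ k b, v ∈ c.side k b := by
  have h1 := notMem_core hG h v
  rw [mem_core_iff 0, zero_add, zero_add] at h1
  have key : ∀ a : Fin 3 → Bool, ¬ (a 1 = a 0 ∧ a 2 = a 0) →
      ∃ k b, a k = (!b) ∧ ∀ j ≠ k, a j = b := by decide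
  exact key (fun i => c.a i v) h1

theorem side_unique {v : G.V} {k l : Fin 3} {b d : Bool} (h1 : v ∈ c.side k b)
    (h2 : v ∈ c.side l d) : k = l ∧ b = d := by
  have key : ∀ (a : Fin 3 → Bool) (k l : Fin 3) (b d : Bool), (a k = (!b) ∧ ∀ j ≠ k, a j = b) →
      (a l = (!d) ∧ ∀ j ≠ l, a j = d) → k = l ∧ b = d := by decide
  exact key (fun i => c.a i v) k l b d h1 h2

theorem ne_and_eq_of_mem_side (hG : G.MatchingCovered) (h : ∀ i b, c.sign i b = true) {v : G.V}
    {i k : Fin 3} {b d : Bool} (hv : v ∈ c.side k d) (hr : v ∈ G.ends (c.r i b)) :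
    i ≠ k ∧ b = d := by
  have h1 := sign_eq hG hr
  rw [h] at h1
  have hik : i ≠ k := by
    rintro rfl
    rw [hv.2 _ (fin_three_add_one_ne i), hv.2 _ (fin_three_add_two_ne i)] at h1
    simp at h1
  exact ⟨hik, by rw [← c.mono i b v hr, hv.2 i hik]⟩

theorem other_end_mem_side (hG : G.MatchingCovered) {i j k : Fin 3} (hij : i ≠ j) (hik : i ≠ k)
    (hjk : j ≠ k) {v w : G.V} {b : Bool} (hv : v ∈ c.side k b)
    (hr : G.ends (c.r i b) = s(v, w)) : w ∈ c.side j b := by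
  refine ⟨?_, fun l hl => ?_⟩
  · rw [flip_r hG hij.symm hr, hv.2 j hjk]
  · rcases fin_three_eq_or hij hik hjk l with rfl | rfl | rfl
    · exact (ends_r hr).2
    · exact absurd rfl hl
    · rw [flip_r hG hik.symm hr, hv.1, Bool.not_not]

theorem exists_end_mem_side (hG : G.MatchingCovered) (h : ∀ i b, c.sign i b = true)
    {i k : Fin 3} (hik : i ≠ k) (b : Bool) : ∃ x ∈ c.side k b, x ∈ G.ends (c.r i b) := by
  obtain ⟨v, w, hr⟩ := exists_ends (c.r i b)
  obtain ⟨l, d, hl⟩ := exists_mem_side hG h v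
  obtain ⟨hil, rfl⟩ := ne_and_eq_of_mem_side hG h hl (i := i) (b := b) (by simp [hr])
  by_cases hlk : l = k
  · subst hlk
    exact ⟨v, hl, by simp [hr]⟩
  · exact ⟨w, other_end_mem_side hG hik hil (Ne.symm hlk) hl hr, by simp [hr]⟩

theorem other_end_notMem_side (hG : G.MatchingCovered) (h : ∀ i b, c.sign i b = true)
    {i k : Fin 3} {v w : G.V} {b d : Bool} (hv : v ∈ c.side k b)
    (hr : G.ends (c.r i b) = s(v, w)) : w ∉ c.side k d := by
  intro hw
  obtain ⟨hik, rfl⟩ := ne_and_eq_of_mem_side hG h hw (i := i) (b := b) (by simp [hr])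
  have h1 := flip_r hG hik.symm hr
  rw [hv.1, hw.1] at h1
  simp at h1

theorem eq_of_mem_side (hG : G.MatchingCovered) (h : ∀ i b, c.sign i b = true) {i k : Fin 3}
    {v w : G.V} {b d : Bool} (hv : v ∈ c.side k b) (hw : w ∈ c.side k d)
    (hr : v ∈ G.ends (c.r i b)) (hr' : w ∈ G.ends (c.r i b)) : v = w := by
  obtain ⟨u, hu⟩ := exists_ends_of_mem hr
  rw [hu, Sym2.mem_iff] at hr'
  rcases hr' with rfl | rfl
  · rfl
  · exact absurd hw (other_end_notMem_side hG h hv hu)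

theorem mate_mem_side (hG : G.MatchingCovered) (h : ∀ i b, c.sign i b = true) (P : PM G)
    {k : Fin 3} {b : Bool} {v : G.V} (hv : v ∈ c.side k b) :
    (∃ i, i ≠ k ∧ P.edge v = c.r i b ∧ ∀ d, P.mate v ∉ c.side k d) ∨
      P.mate v ∈ c.side k (!b) := by
  by_cases hg : ∃ i d, P.edge v = c.r i d
  · obtain ⟨i, d, hid⟩ := hg
    have h1 := P.ends_edge v
    rw [hid] at h1
    obtain ⟨hik, rfl⟩ := ne_and_eq_of_mem_side hG h hv (i := i) (b := d) (by simp [h1])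
    exact Or.inl ⟨i, hik, hid, fun d => other_end_notMem_side hG h hv h1⟩
  · push Not at hg
    refine Or.inr ⟨?_, fun j hj => ?_⟩
    · rw [c.flip k _ _ _ (P.ends_edge v) (hg k), hv.1]
    · rw [c.flip j _ _ _ (P.ends_edge v) (hg j), hv.2 j hj]

theorem exists_side_side (hG : G.MatchingCovered) (h : ∀ i b, c.sign i b = true) (k : Fin 3) :
    ∃ x ∈ c.side k true, ∃ y ∈ c.side k false, x ≠ y := by
  obtain ⟨x, hx, -⟩ := exists_end_mem_side hG h (fin_three_add_one_ne k) true
  obtain ⟨y, hy, -⟩ := exists_end_mem_side hG h (fin_three_add_one_ne k) false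
  refine ⟨x, hx, y, hy, ?_⟩
  rintro rfl
  simpa using (side_unique hx hy).2

theorem side_subsingleton_of_forall_mem (hG : G.IsBrick) (h : ∀ i b, c.sign i b = true)
    {k : Fin 3} {b : Bool} {x : G.V} (hx : x ∈ c.side k b)
    (hxr : ∀ l, l ≠ k → x ∈ G.ends (c.r l b)) (d : Bool) : (c.side k d).Subsingleton := by
  have hX : ¬ {v | v ≠ x ∧ ∃ d, v ∈ c.side k d}.Nontrivial := by
    intro hX
    refine hG.false_of_tight hX ?_ fun P => ?_
    · obtain ⟨u, hu, w, hw, huw⟩ := exists_side_side hG.1 h (k + 1)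
      refine ⟨u, ?_, w, ?_, huw⟩
      · rintro ⟨-, d, hd⟩
        exact fin_three_add_one_ne k (side_unique hu hd).1
      · rintro ⟨-, d, hd⟩
        exact fin_three_add_one_ne k (side_unique hw hd).1
    · by_cases hP : ∃ l, l ≠ k ∧ P.Has (c.r l b)
      · obtain ⟨l, hl, hPl⟩ := hP
        have hPl' := c.pair P l b hPl
        obtain ⟨y, hy, hyr⟩ := exists_end_mem_side hG.1 h hl (!b)
        obtain ⟨z, hz⟩ := exists_ends_of_mem hyr
        refine ⟨y, ⟨⟨?_, _, hy⟩, ?_⟩, ?_⟩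
        · rintro rfl
          simpa using (side_unique hx hy).2
        · rw [hPl'.mate_eq hz]
          rintro ⟨-, d, hd⟩
          exact other_end_notMem_side hG.1 h hy hz hd
        · rintro v ⟨⟨hvx, d, hd⟩, hv⟩
          rcases mate_mem_side hG.1 h P hd with ⟨m, hm, hvm, -⟩ | hvd
          · obtain rfl := c.excl P m l _ _ ⟨v, hvm⟩ hPl
            have hvr := P.mem_ends v
            rw [hvm] at hvr
            by_cases hdb : d = b
            · subst hdb
              exact absurd (eq_of_mem_side hG.1 h hd hx hvr (hxr m hm)) hvx
            · obtain rfl : d = !b := Bool.eq_not.2 hdb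
              exact eq_of_mem_side hG.1 h hd hy hvr hyr
          · have hmx : P.mate v = x := by
              by_contra hne
              exact hv ⟨hne, _, hvd⟩
            obtain ⟨z, hz⟩ := exists_ends_of_mem (hxr l hl)
            have h1 := hPl.mate_eq hz
            rw [← hmx, P.mate_mate] at h1
            subst h1
            exact absurd hd (other_end_notMem_side hG.1 h hx hz)
      · have hin : ∀ v d, v ∈ c.side k d → P.mate v ∈ c.side k (!d) := by
          intro v d hv
          rcases mate_mem_side hG.1 h P hv with ⟨m, hm, hvm, -⟩ | hvd
          · refine absurd ⟨m, hm, ?_⟩ hP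
            by_cases hdb : d = b
            · exact ⟨v, hdb ▸ hvm⟩
            · obtain rfl : b = !d := Bool.eq_not.2 (Ne.symm hdb)
              exact c.pair P m d ⟨v, hvm⟩
          · exact hvd
        refine ⟨P.mate x, ⟨⟨P.mate_ne x, _, hin x b hx⟩, by simp⟩, ?_⟩
        rintro v ⟨⟨hvx, d, hd⟩, hv⟩
        have hmx : P.mate v = x := by
          by_contra hne
          exact hv ⟨hne, _, hin v d hd⟩
        rw [← hmx, P.mate_mate]
  rw [Set.not_nontrivial_iff] at hX
  obtain ⟨y, hy⟩ : (c.side k (!b)).Nonempty := by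
    obtain ⟨y, hy, -⟩ := exists_end_mem_side hG.1 h (fin_three_add_one_ne k) (!b)
    exact ⟨y, hy⟩
  have hne : ∀ z ∈ c.side k (!b), z ≠ x := by
    rintro z hz rfl
    simpa using (side_unique hx hz).2
  intro u hu w hw
  by_cases hdb : d = b
  · subst hdb
    have key : ∀ z ∈ c.side k d, z = x := by
      intro z hz
      by_contra hzx
      have := hX ⟨hzx, _, hz⟩ ⟨hne y hy, _, hy⟩
      subst this
      simpa using (side_unique hz hy).2
    rw [key u hu, key w hw]
  · obtain rfl : d = !b := Bool.eq_not.2 hdb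
    exact hX ⟨hne u hu, _, hu⟩ ⟨hne w hw, _, hw⟩

end Config
namespace Config

variable {c : Config G}

theorem exists_injective_of_ne (hG : G.IsBrick) (h : ∀ i b, c.sign i b = true) {i j k : Fin 3}
    (hij : i ≠ j) (hik : i ≠ k) (hjk : j ≠ k) {p q p' q' : G.V}
    (hp : p ∈ c.side k true) (hq : q ∈ c.side k true) (hp' : p' ∈ c.side k false)
    (hq' : q' ∈ c.side k false) (hpr : p ∈ G.ends (c.r i true)) (hqr : q ∈ G.ends (c.r j true))
    (hpr' : p' ∈ G.ends (c.r i false)) (hqr' : q' ∈ G.ends (c.r j false))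
    (hpq : p ≠ q) (hpq' : p' ≠ q') :
    ∃ f : {v // v ∈ c.side k true ∧ v ≠ p ∧ v ≠ q} → G.V, Function.Injective f ∧
      ∀ v, f v ∈ c.side k false ∧ f v ≠ p' ∧ f v ≠ q' ∧ ∃ g, G.ends g = s(v.1, f v) := by
  classical
  let t : {v // v ∈ c.side k true ∧ v ≠ p ∧ v ≠ q} → Finset G.V := fun v =>
    Finset.univ.filter fun w => w ∈ c.side k false ∧ w ≠ p' ∧ w ≠ q' ∧ ∃ g, G.ends g = s(v.1, w)
  by_contra! hcon
  have hall : ¬ ∀ s : Finset {v // v ∈ c.side k true ∧ v ≠ p ∧ v ≠ q}, s.card ≤ (s.biUnion t).card := by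
    rw [Finset.all_card_le_biUnion_card_iff_exists_injective]
    rintro ⟨f, hf, hft⟩
    obtain ⟨v, hv⟩ := hcon f hf
    have := hft v
    simp only [t, Finset.mem_filter, Finset.mem_univ, true_and] at this
    obtain ⟨h1, h2, h3, g, hg⟩ := this
    exact hv h1 h2 h3 g hg
  push Not at hall
  obtain ⟨s, hs⟩ := hall
  let S : Finset G.V := s.map (Function.Embedding.subtype _)
  have hScard : S.card = s.card := Finset.card_map _
  have hS : ∀ v ∈ S, v ∈ c.side k true ∧ v ≠ p ∧ v ≠ q := by
    intro v hv
    obtain ⟨u, -, rfl⟩ := Finset.mem_map.1 hv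
    exact u.2
  let N : Finset G.V := Finset.univ.filter fun w =>
    w ∈ c.side k false ∧ ∃ v ∈ S, ∃ g, G.ends g = s(v, w)
  have hNmem : ∀ w, w ∈ N ↔ w ∈ c.side k false ∧ ∃ v ∈ S, ∃ g, G.ends g = s(v, w) := by
    intro w
    simp [N]
  have hNt : (N.erase p').erase q' ⊆ s.biUnion t := by
    intro w hw
    simp only [Finset.mem_erase, hNmem] at hw
    obtain ⟨hw1, hw2, hw3, v, hv, hg⟩ := hw
    obtain ⟨u, hu, rfl⟩ := Finset.mem_map.1 hv
    simp only [Finset.mem_biUnion, t, Finset.mem_filter, Finset.mem_univ, true_and]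
    exact ⟨u, hu, hw3, hw2, hw1, hg⟩
  have hSN : ∀ P : PM G, ∀ v ∈ S, P.mate v ∈ N := by
    intro P v hv
    obtain ⟨h1, h2, h3⟩ := hS v hv
    rcases mate_mem_side hG.1 h P h1 with ⟨l, hl, hvl, -⟩ | hm
    · exfalso
      have hvr := P.mem_ends v
      rw [hvl] at hvr
      rcases fin_three_eq_or hij hik hjk l with rfl | rfl | rfl
      · exact h2 (eq_of_mem_side hG.1 h h1 hp hvr hpr)
      · exact h3 (eq_of_mem_side hG.1 h h1 hq hvr hqr)
      · exact hl rfl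
    · exact (hNmem _).2 ⟨hm, v, hv, _, P.ends_edge v⟩
  have hlt := hs.trans_le' (Finset.card_le_card hNt)
  have hle : ∀ l, ∀ x ∈ c.side k false, x ∈ G.ends (c.r l false) →
      S.card ≤ (N.erase x).card := by
    intro l x hx hxr
    obtain ⟨P, hP⟩ := hG.1.exists_pm (c.r l false)
    rw [← Finset.card_image_of_injective S P.mate_injective]
    refine Finset.card_le_card fun w hw => ?_
    obtain ⟨v, hv, rfl⟩ := Finset.mem_image.1 hw
    refine Finset.mem_erase.2 ⟨?_, hSN P v hv⟩
    rintro rfl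
    obtain ⟨z, hz⟩ := exists_ends_of_mem hxr
    have h1 := hP.mate_eq hz
    rw [P.mate_mate] at h1
    subst h1
    exact other_end_notMem_side hG.1 h hx hz (hS v hv).1
  have hle1 := hle i p' hp' hpr'
  have hle2 := hle j q' hq' hqr'
  have hp'N : p' ∈ N := by
    by_contra hn
    rw [Finset.erase_eq_of_notMem hn] at hlt
    omega
  have hq'N : q' ∈ N := by
    by_contra hn
    rw [Finset.erase_right_comm, Finset.erase_eq_of_notMem hn] at hlt
    omega
  have hcard : N.card = S.card + 1 := by
    have h1 := Finset.card_erase_add_one hp'N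
    have h2 := Finset.card_erase_add_one (Finset.mem_erase.2 ⟨hpq'.symm, hq'N⟩)
    omega
  have hdisj : ∀ v ∈ c.side k true, v ∉ N := by
    intro v hv hN
    simpa using (side_unique hv ((hNmem v).1 hN).1).2
  refine hG.false_of_card_eq_add_one hcard hSN ?_ ⟨p', hp'N, q', hq'N, hpq'⟩ ⟨p, ?_, q, ?_, hpq⟩
  · intro P v hv hv'
    have h1 := ((hNmem v).1 hv).1
    have h2 := ((hNmem _).1 hv').1
    rcases mate_mem_side hG.1 h P h1 with ⟨l, hl, -, hd⟩ | hm
    · exact hd _ h2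
    · simpa using (side_unique hm h2).2
  · exact ⟨fun hS' => (hS p hS').2.1 rfl, hdisj p hp⟩
  · exact ⟨fun hS' => (hS q hS').2.2 rfl, hdisj q hq⟩

open Classical in
theorem card_side_le (hG : G.MatchingCovered) (h : ∀ i b, c.sign i b = true) (k : Fin 3)
    (b : Bool) : (c.side k b).toFinset.card ≤ (c.side k (!b)).toFinset.card := by
  obtain ⟨P, hP⟩ := hG.exists_pm (c.r k b)
  refine Finset.card_le_card_of_injOn P.mate ?_ P.mate_injective.injOn
  intro v hv
  simp only [Set.coe_toFinset] at hv ⊢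
  rcases mate_mem_side hG h P hv with ⟨l, hl, hvl, -⟩ | hm
  · exact absurd (c.excl P l k _ _ ⟨v, hvl⟩ hP) hl
  · exact hm

theorem mate_mem_of_has (hG : G.MatchingCovered) (h : ∀ i b, c.sign i b = true) {i j k : Fin 3}
    (hij : i ≠ j) (hik : i ≠ k) (hjk : j ≠ k) {p p' : G.V} (hp : p ∈ c.side k true)
    (hp' : p' ∈ c.side k false) (hpr : p ∈ G.ends (c.r i true))
    (hpr' : p' ∈ G.ends (c.r i false)) {P : PM G} (hP : ∀ b, P.Has (c.r i b)) {v : G.V}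
    (hv : v ∈ {v | (∃ d, v ∈ c.side j d) ∨ v = p ∨ v = p'}) :
    P.mate v ∈ {v | (∃ d, v ∈ c.side j d) ∨ v = p ∨ v = p'} := by
  rcases hv with ⟨d, hd⟩ | rfl | rfl
  · rcases mate_mem_side hG h P hd with ⟨l, hl, hvl, -⟩ | hm
    · obtain rfl := c.excl P l i d true ⟨v, hvl⟩ (hP true)
      have hr := P.ends_edge v
      rw [hvl] at hr
      have hm := other_end_mem_side hG hik hl hjk.symm hd hr
      have hmr : P.mate v ∈ G.ends (c.r l d) := by simp [hr]
      cases d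
      · exact Or.inr (Or.inr (eq_of_mem_side hG h hm hp' hmr hpr'))
      · exact Or.inr (Or.inl (eq_of_mem_side hG h hm hp hmr hpr))
    · exact Or.inl ⟨_, hm⟩
  · obtain ⟨z, hz⟩ := exists_ends_of_mem hpr
    rw [(hP true).mate_eq hz]
    exact Or.inl ⟨_, other_end_mem_side hG hij hik hjk hp hz⟩
  · obtain ⟨z, hz⟩ := exists_ends_of_mem hpr'
    rw [(hP false).mate_eq hz]
    exact Or.inl ⟨_, other_end_mem_side hG hij hik hjk hp' hz⟩

theorem false_of_ne (hG : G.IsBrick) (h : ∀ i b, c.sign i b = true) {i j k : Fin 3}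
    (hij : i ≠ j) (hik : i ≠ k) (hjk : j ≠ k) {p q p' q' : G.V}
    (hp : p ∈ c.side k true) (hq : q ∈ c.side k true) (hp' : p' ∈ c.side k false)
    (hq' : q' ∈ c.side k false) (hpr : p ∈ G.ends (c.r i true)) (hqr : q ∈ G.ends (c.r j true))
    (hpr' : p' ∈ G.ends (c.r i false)) (hqr' : q' ∈ G.ends (c.r j false))
    (hpq : p ≠ q) (hpq' : p' ≠ q') : False := by
  classical
  obtain ⟨f, hf, hf'⟩ :=
    exists_injective_of_ne hG h hij hik hjk hp hq hp' hq' hpr hqr hpr' hqr' hpq hpq'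
  choose hf1 hf2 hf3 e he using hf'
  have hne : ∀ {u w}, u ∈ c.side k true → w ∈ c.side k false → u ≠ w := by
    rintro u w hu hw rfl
    simpa using (side_unique hu hw).2
  have hsurj : ∀ w, w ∈ c.side k false → w ≠ p' → w ≠ q' → ∃ u, f u = w := by
    have hsub : Finset.univ.image f ⊆ ((c.side k false).toFinset.erase p').erase q' := by
      intro w hw
      obtain ⟨u, -, rfl⟩ := Finset.mem_image.1 hw
      simp [hf1, hf2, hf3]
    have heq := Finset.eq_of_subset_of_card_le hsub (by
      rw [Finset.card_image_of_injective _ hf, Finset.card_univ, Fintype.card_subtype,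
        Finset.card_erase_of_mem (by simp [hq', hpq'.symm]), Finset.card_erase_of_mem (by simpa),
        show (Finset.univ.filter fun v => v ∈ c.side k true ∧ v ≠ p ∧ v ≠ q) =
          ((c.side k true).toFinset.erase p).erase q by ext; simp; tauto,
        Finset.card_erase_of_mem (by simp [hq, hpq.symm]), Finset.card_erase_of_mem (by simpa)]
      have := card_side_le hG.1 h k false
      rw [Bool.not_false] at this
      omega)
    intro w h1 h2 h3
    have : w ∈ Finset.univ.image f := by
      rw [heq]
      simp [h1, h2, h3]
    simpa using this
  let μ : G.V → G.E := fun v => if h : ∃ u, v ∈ G.ends (e u) then e h.choose else c.r i true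
  have hμ : ∀ u v, v ∈ G.ends (e u) → μ v = e u := by
    intro u v hv
    have hex : ∃ u, v ∈ G.ends (e u) := ⟨u, hv⟩
    simp only [μ, dif_pos hex]
    have h1 := hex.choose_spec
    generalize hex.choose = u' at h1
    congr 1
    rw [he, Sym2.mem_iff] at h1 hv
    rcases hv with rfl | rfl <;> rcases h1 with h1 | h1
    · exact Subtype.ext h1.symm
    · exact absurd h1 (hne u.2.1 (hf1 u'))
    · exact absurd h1.symm (hne u'.2.1 (hf1 u))
    · exact (hf h1).symm
  obtain ⟨P, hP⟩ := hG.1.exists_pm (c.r i true)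
  obtain ⟨Q, hQ⟩ := hG.1.exists_pm (c.r j true)
  have hPb : ∀ b, P.Has (c.r i b) := Bool.forall_bool.2 ⟨c.pair P i true hP, hP⟩
  have hQb : ∀ b, Q.Has (c.r j b) := Bool.forall_bool.2 ⟨c.pair Q j true hQ, hQ⟩
  have hnmem : ∀ {v d x x'} {l : Fin 3}, v ∈ c.side k d → k ≠ l → v ≠ x → v ≠ x' →
      v ∉ {v | (∃ d, v ∈ c.side l d) ∨ v = x ∨ v = x'} := by
    rintro v d x x' l hv hkl h1 h2 (⟨d', hd'⟩ | h3 | h3)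
    · exact hkl (side_unique hv hd').1
    · exact h1 h3
    · exact h2 h3
  obtain ⟨R, hR1, hR2⟩ := P.exists_glue Q (X := {v | (∃ d, v ∈ c.side j d) ∨ v = p ∨ v = p'})
    (Y := {v | (∃ d, v ∈ c.side i d) ∨ v = q ∨ v = q'})
    (fun v => mate_mem_of_has hG.1 h hij hik hjk hp hp' hpr hpr' hPb)
    (fun v => mate_mem_of_has hG.1 h hij.symm hjk hik hq hq' hqr hqr' hQb) (by
      rintro v (⟨d, hd⟩ | rfl | rfl)
      · rintro (⟨d', hd'⟩ | rfl | rfl)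
        · exact hij (side_unique hd hd').1.symm
        · exact hjk (side_unique hd hq).1
        · exact hjk (side_unique hd hq').1
      · exact hnmem hp hik.symm hpq (hne hp hq')
      · exact hnmem hp' hik.symm (hne hq hp').symm hpq') μ (by
      intro v hv1 hv2
      simp only [Set.mem_ofPred_eq, not_or, not_exists] at hv1 hv2
      obtain ⟨l, d, hd⟩ := exists_mem_side hG.1 h v
      have hex : ∃ u, v ∈ G.ends (e u) := by
        rcases fin_three_eq_or hij hik hjk l with rfl | rfl | rfl
        · exact absurd hd (hv2.1 _)
        · exact absurd hd (hv1.1 _)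
        · cases d
          · obtain ⟨u, rfl⟩ := hsurj v hd hv1.2.2 hv2.2.2
            exact ⟨u, by simp [he]⟩
          · exact ⟨⟨v, hd, hv1.2.1, hv2.2.1⟩, by simp [he]⟩
      obtain ⟨u, hu⟩ := hex
      rw [hμ u v hu]
      refine ⟨hu, fun w hw => ?_⟩
      have hw' := hw
      rw [he, Sym2.mem_iff] at hw'
      rcases hw' with rfl | rfl
      · exact ⟨hnmem u.2.1 hjk.symm u.2.2.1 (hne u.2.1 hp'),
          hnmem u.2.1 hik.symm u.2.2.2 (hne u.2.1 hq'), hμ u _ hw⟩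
      · exact ⟨hnmem (hf1 u) hjk.symm (hne hp (hf1 u)).symm (hf2 u),
          hnmem (hf1 u) hik.symm (hne hq (hf1 u)).symm (hf3 u), hμ u _ hw⟩)
  refine hij (c.excl R i j true true ⟨p, ?_⟩ ⟨q, ?_⟩)
  · rw [hR1 p (by simp), hP.edge_eq hpr]
  · rw [hR2 q (by simp), hQ.edge_eq hqr]

theorem side_subsingleton (hG : G.IsBrick) (h : ∀ i b, c.sign i b = true) (k : Fin 3)
    (b : Bool) : (c.side k b).Subsingleton := by
  have h1 := fin_three_add_one_ne k
  have h2 := fin_three_add_two_ne k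
  have h12 : k + 1 ≠ k + 2 := by revert k; decide
  obtain ⟨p, hp, hpr⟩ := exists_end_mem_side hG.1 h h1 true
  obtain ⟨p', hp', hpr'⟩ := exists_end_mem_side hG.1 h h1 false
  obtain ⟨q, hq, hqr⟩ := exists_end_mem_side hG.1 h h2 true
  obtain ⟨q', hq', hqr'⟩ := exists_end_mem_side hG.1 h h2 false
  by_cases hpq : p = q
  · subst hpq
    refine side_subsingleton_of_forall_mem hG h hp (fun l hl => ?_) b
    rcases fin_three_cases k l with rfl | rfl | rfl
    exacts [absurd rfl hl, hpr, hqr]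
  by_cases hpq' : p' = q'
  · subst hpq'
    refine side_subsingleton_of_forall_mem hG h hp' (fun l hl => ?_) b
    rcases fin_three_cases k l with rfl | rfl | rfl
    exacts [absurd rfl hl, hpr', hqr']
  exact (false_of_ne hG h h12 h1 h2 hp hq hp' hq' hpr hqr hpr' hqr' hpq hpq').elim

end Config
theorem PM.exists_replace (P : PM G) {v : G.V} {g : G.E} (hg : G.ends g = G.ends (P.edge v)) :
    ∃ R : PM G, R.edge v = g ∧ ∀ u ∉ G.ends g, R.edge u = P.edge u := by
  classical
  refine ⟨PM.ofMap (fun u => if u ∈ G.ends g then g else P.edge u) ?_ ?_, ?_, ?_⟩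
  · intro u
    split_ifs with h
    · exact h
    · exact P.mem_ends u
  · intro u w
    split_ifs with h1 h2 h3
    · intro
      rfl
    · intro h
      exact absurd h h2
    · intro h
      have h4 := (P.has_edge u).edge_eq h
      have h5 := (P.has_edge v).edge_eq (hg ▸ h3)
      rw [hg, ← h5, h4] at h1
      exact absurd (P.mem_ends u) h1
    · intro h
      exact (P.has_edge u).edge_eq h
  · have := P.mem_ends v
    rw [← hg] at this
    simp [this]
  · intro u hu
    simp [hu]

theorem fin_three_add_one_ne_add_two (i : Fin 3) : i + 1 ≠ i + 2 := by
  revert i; decide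

namespace Config

variable {c : Config G}

theorem mem_side_not {k : Fin 3} {b : Bool} {g : G.E} {u w : G.V} (hg : G.ends g = s(u, w))
    (hr : ∀ i d, g ≠ c.r i d) (hu : u ∈ c.side k b) : w ∈ c.side k (!b) := by
  refine ⟨?_, fun j hj => ?_⟩
  · rw [c.flip k g u w hg (hr k), hu.1]
  · rw [c.flip j g u w hg (hr j), hu.2 j hj]

theorem mate_mem_side_of_has (hG : G.MatchingCovered) (h : ∀ i b, c.sign i b = true) {P : PM G}
    {k : Fin 3} (hP : P.Has (c.r k true)) {b : Bool} {v : G.V} (hv : v ∈ c.side k b) :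
    P.mate v ∈ c.side k (!b) := by
  rcases mate_mem_side hG h P hv with ⟨l, hl, hvl, -⟩ | hm
  · exact absurd (c.excl P l k _ _ ⟨v, hvl⟩ hP) hl
  · exact hm

theorem isIso_C6bar (hG : G.IsBrick) (h : ∀ i b, c.sign i b = true) {v : G.V}
    (hmax : ∀ u, G.degree u ≤ G.degree v) {g : Fin 3 → G.E} (hvg : ∀ i, v ∈ G.ends (g i))
    (hg : ∀ i b, Dep (c.r i b) (g i)) : IsIso G C6bar := by
  classical
  have hpt : ∀ k b, ∃ x ∈ c.side k b, ∀ y ∈ c.side k b, y = x := by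
    intro k b
    obtain ⟨x, hx, -⟩ := exists_end_mem_side hG.1 h (fin_three_add_one_ne k) b
    exact ⟨x, hx, fun y hy => side_subsingleton hG h k b hy hx⟩
  choose pt hpt hpt' using hpt
  have hrung : ∀ (e : G.E) k b, (∀ i d, e ≠ c.r i d) → pt k b ∈ G.ends e →
      G.ends e = s(pt k b, pt k !b) := by
    intro e k b he hk
    obtain ⟨w, hw⟩ := exists_ends_of_mem hk
    rw [hw, hpt' k (!b) w (mem_side_not hw he (hpt k b))]
  have hdeg : ∀ u, G.degree u ≤ 3 := by
    refine fun u => (hmax u).trans ?_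
    obtain ⟨k, b, hv⟩ := exists_mem_side hG.1 h v
    obtain ⟨P, hP⟩ := hG.1.exists_pm (c.r k true)
    have hsub : {e | G.Inc v e} ⊆ ({c.r (k + 1) b, c.r (k + 2) b, g k} : Set G.E) := by
      intro e he
      change v ∈ G.ends e at he
      by_cases hr : ∃ i d, e = c.r i d
      · obtain ⟨i, d, rfl⟩ := hr
        obtain ⟨hik, rfl⟩ := ne_and_eq_of_mem_side hG.1 h hv he
        rcases fin_three_cases k i with rfl | rfl | rfl
        · exact absurd rfl hik
        · simp
        · simp
      · push Not at hr
        right; right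
        have hvp := hpt' k b v hv
        subst hvp
        have h1 := hrung e k b hr he
        have hm := mate_mem_side_of_has hG.1 h hP (hpt k b)
        have h2 : G.ends e = G.ends (P.edge (pt k b)) := by
          rw [P.ends_edge, h1, hpt' _ _ _ hm]
        obtain ⟨R, hR1, hR2⟩ := P.exists_replace h2
        have hRr : R.Has (c.r k true) := by
          obtain ⟨x, hx⟩ := hP
          refine ⟨x, ?_⟩
          rw [hR2, hx]
          intro hxe
          have hxr := P.mem_ends x
          rw [hx] at hxr
          rw [h1, Sym2.mem_iff] at hxe
          rcases hxe with rfl | rfl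
          · exact (ne_and_eq_of_mem_side hG.1 h (hpt k b) hxr).1 rfl
          · exact (ne_and_eq_of_mem_side hG.1 h (hpt k !b) hxr).1 rfl
        have h3 := (hg k true R hRr).edge_eq (hvg k)
        rw [hR1] at h3
        exact h3
    calc G.degree v = {e | G.Inc v e}.ncard := rfl
      _ ≤ ({c.r (k + 1) b, c.r (k + 2) b, g k} : Set G.E).ncard :=
        Set.ncard_le_ncard hsub (Set.toFinite _)
      _ ≤ 3 := Set.ncard_insert_le _ _ |>.trans
        (Nat.add_le_add_right ((Set.ncard_insert_le _ _).trans (by simp)) 1)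
  have hmemr : ∀ i k b, i ≠ k → pt k b ∈ G.ends (c.r i b) := by
    intro i k b hik
    obtain ⟨x, hx, hxr⟩ := exists_end_mem_side hG.1 h hik b
    rwa [← hpt' k b x hx]
  have hunique : ∀ k b e e', (∀ i d, e ≠ c.r i d) → (∀ i d, e' ≠ c.r i d) →
      pt k b ∈ G.ends e → pt k b ∈ G.ends e' → e = e' := by
    intro k b e e' he he' hk hk'
    by_contra hne
    have h1 := hdeg (pt k b)
    have hsub : (({c.r (k + 1) b, c.r (k + 2) b, e, e'} : Finset G.E) : Set G.E) ⊆
        {e | G.Inc (pt k b) e} := by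
      intro x hx
      simp only [Finset.coe_insert, Finset.coe_singleton, Set.mem_insert_iff,
        Set.mem_singleton_iff] at hx
      rcases hx with rfl | rfl | rfl | rfl
      · exact hmemr _ _ _ (fin_three_add_one_ne k)
      · exact hmemr _ _ _ (fin_three_add_two_ne k)
      · exact hk
      · exact hk'
    have h2 := Set.ncard_le_ncard hsub (Set.toFinite _)
    rw [Set.ncard_coe_finset] at h2
    have h3 : ({c.r (k + 1) b, c.r (k + 2) b, e, e'} : Finset G.E).card = 4 := by
      rw [Finset.card_insert_of_notMem, Finset.card_insert_of_notMem, Finset.card_pair hne]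
      · simp [(he _ _).symm, (he' _ _).symm]
      · simp only [Finset.mem_insert, Finset.mem_singleton, (he _ _).symm, (he' _ _).symm, or_false]
        exact fun h' => fin_three_add_one_ne_add_two k (r_injective hG.1 h').1
    have h4 : G.degree (pt k b) = {e | G.Inc (pt k b) e}.ncard := rfl
    omega
  have hadj : ∀ k b l d, (∃ e, G.ends e = s(pt k b, pt l d)) ↔
      b = d ∧ k ≠ l ∨ k = l ∧ b ≠ d := by
    intro k b l d
    constructor
    · rintro ⟨e, he⟩
      by_cases hr : ∃ i d, e = c.r i d
      · obtain ⟨i, d', rfl⟩ := hr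
        obtain ⟨hik, rfl⟩ := ne_and_eq_of_mem_side hG.1 h (hpt k b) (i := i) (b := d')
          (by simp [he])
        obtain ⟨hil, rfl⟩ := ne_and_eq_of_mem_side hG.1 h (hpt l d) (i := i) (b := d')
          (by simp [he])
        refine Or.inl ⟨rfl, ?_⟩
        rintro rfl
        exact ne_of_ends he rfl
      · push Not at hr
        obtain ⟨rfl, rfl⟩ := side_unique (mem_side_not he hr (hpt k b)) (hpt l d)
        exact Or.inr ⟨rfl, by simp⟩
    · rintro (⟨rfl, hkl⟩ | ⟨rfl, hbd⟩)
      · obtain ⟨i, hik, hil⟩ : ∃ i : Fin 3, i ≠ k ∧ i ≠ l := by revert k l; decide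
        obtain ⟨w, hw⟩ := exists_ends_of_mem (hmemr i k b hik)
        refine ⟨_, hw.trans ?_⟩
        rw [hpt' l b w (other_end_mem_side hG.1 hil hik hkl.symm (hpt k b) hw)]
      · obtain ⟨P, hP⟩ := hG.1.exists_pm (c.r k true)
        refine ⟨P.edge (pt k b), ?_⟩
        rw [P.ends_edge, hpt' _ _ _ (mate_mem_side_of_has hG.1 h hP (hpt k b)), Bool.eq_not.2 hbd.symm]
  have hbij : Function.Bijective fun x : Fin 3 × Bool => pt x.1 x.2 := by
    constructor
    · rintro ⟨k, b⟩ ⟨l, d⟩ hx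
      have h1 := hpt k b
      rw [show pt k b = pt l d from hx] at h1
      obtain ⟨rfl, rfl⟩ := side_unique h1 (hpt l d)
      rfl
    · intro u
      obtain ⟨k, b, hu⟩ := exists_mem_side hG.1 h u
      exact ⟨(k, b), (hpt' k b u hu).symm⟩
  have hbij' : Function.Bijective fun x : Fin 3 × Bool =>
      (2 * (x.1.1 : ZMod 6) + if x.2 then 0 else 3) := by decide
  have hC : ∀ x y : ZMod 6, (∃ e, C6bar.ends e = s(x, y)) ↔ x ≠ y ∧ y ≠ x + 1 ∧ x ≠ y + 1 := by
    intro x y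
    constructor
    · rintro ⟨⟨e, he1, he2⟩, he⟩
      change e = s(x, y) at he
      subst he
      exact ⟨fun h' => he1 (Sym2.mk_isDiag_iff.2 h'), he2 x y rfl⟩
    · rintro ⟨h1, h2, h3⟩
      refine ⟨⟨s(x, y), fun h' => h1 (Sym2.mk_isDiag_iff.1 h'), fun a b hab => ?_⟩, rfl⟩
      rcases Sym2.eq_iff.1 hab with ⟨rfl, rfl⟩ | ⟨rfl, rfl⟩
      · exact ⟨h2, h3⟩
      · exact ⟨h3, h2⟩
  let ψ : Fin 3 × Bool ≃ G.V := Equiv.ofBijective _ hbij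
  let χ : Fin 3 × Bool ≃ C6bar.V := Equiv.ofBijective _ hbij'
  refine isIso_of_simple (ψ.symm.trans χ) ?_ Subtype.val_injective fun u w => ?_
  · intro e e' hee
    obtain ⟨u, w, he⟩ := exists_ends e
    have he' := hee ▸ he
    obtain ⟨k, b, hu⟩ := exists_mem_side hG.1 h u
    by_cases hr : ∃ i d, e = c.r i d
    · obtain ⟨i, d, rfl⟩ := hr
      obtain ⟨hik, rfl⟩ := ne_and_eq_of_mem_side hG.1 h hu (i := i) (b := d) (by simp [he])
      by_cases hr' : ∃ i d, e' = c.r i d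
      · obtain ⟨i', d', rfl⟩ := hr'
        obtain ⟨hik', rfl⟩ := ne_and_eq_of_mem_side hG.1 h hu (i := i') (b := d') (by simp [he'])
        by_cases hii : i = i'
        · rw [hii]
        · have h1 := other_end_mem_side hG.1 hii hik hik' hu he
          exact absurd rfl (ne_and_eq_of_mem_side hG.1 h h1 (i := i') (b := d') (by simp [he'])).1
      · push Not at hr'
        exact absurd (mem_side_not he' hr' hu) (other_end_notMem_side hG.1 h hu he)
    · push Not at hr
      have h1 := mem_side_not he hr hu
      have hr' : ∀ i d, e' ≠ c.r i d := by
        rintro i d rfl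
        obtain ⟨hik, rfl⟩ := ne_and_eq_of_mem_side hG.1 h hu (i := i) (b := d) (by simp [he'])
        exact other_end_notMem_side hG.1 h hu he' h1
      have hup := hpt' k b u hu
      exact hunique k b e e' hr hr' (by simp [he, ← hup]) (by simp [he', ← hup])
  · obtain ⟨⟨k, b⟩, rfl⟩ := ψ.surjective u
    obtain ⟨⟨l, d⟩, rfl⟩ := ψ.surjective w
    refine (hadj k b l d).trans ?_
    rw [Equiv.trans_apply, Equiv.trans_apply, Equiv.symm_apply_apply, Equiv.symm_apply_apply]
    refine Iff.trans ?_ (hC _ _).symm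
    change _ ↔ (2 * (k.1 : ZMod 6) + if b then 0 else 3) ≠ (2 * (l.1 : ZMod 6) + if d then 0 else 3)
      ∧ (2 * (l.1 : ZMod 6) + if d then 0 else 3) ≠ (2 * (k.1 : ZMod 6) + if b then 0 else 3) + 1
      ∧ (2 * (k.1 : ZMod 6) + if b then 0 else 3) ≠ (2 * (l.1 : ZMod 6) + if d then 0 else 3) + 1
    clear hadj hrung hunique hmemr hpt hpt' hC ψ χ
    clear hbij hbij'
    revert k b l d
    decide

end Config
theorem Config.isIso_K4_or_C6bar (c : Config G) (hG : G.IsBrick) {v : G.V}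
    (hmax : ∀ u, G.degree u ≤ G.degree v) {g : Fin 3 → G.E} (hvg : ∀ i, v ∈ G.ends (g i))
    (hg : ∀ i b, Dep (c.r i b) (g i)) : IsIso G K4 ∨ IsIso G C6bar := by
  by_cases h : ∀ i, c.sign i true ≠ c.sign i false
  · exact Or.inl (isIso_K4 hG h)
  push Not at h
  obtain ⟨i, hi⟩ := h
  have heq : ∀ j b, c.sign j b = c.sign j true := by
    intro j b
    cases b
    · by_contra hj
      exact sign_ne_of_sign_ne hG.1 (Ne.symm hj) i hi
    · rfl
  have hsign : ∀ j b, (c.shift fun j => c.sign j true).sign j b =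
      xor (xor (c.sign 0 true) (c.sign 1 true)) (c.sign 2 true) := by
    intro j b
    rw [sign_shift hG.1, heq]
    have key : ∀ (a : Fin 3 → Bool) j,
      xor (a j) (xor (a (j + 1)) (a (j + 2))) = xor (xor (a 0) (a 1)) (a 2) := by decide
    exact key (fun j => c.sign j true) j
  cases hs : xor (xor (c.sign 0 true) (c.sign 1 true)) (c.sign 2 true)
  · exact (false_of_star hG fun j b => (hsign j b).trans hs).elim
  · exact Or.inr (isIso_C6bar hG (fun j b => (hsign j b).trans hs) hmax hvg fun j b => hg j _)

theorem IsBrick.isIso_of_dep (hG : G.IsBrick) {v : G.V} (hmax : ∀ u, G.degree u ≤ G.degree v)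
    {g e f : Fin 3 → G.E} (hvg : ∀ i, v ∈ G.ends (g i)) (hginj : Function.Injective g)
    (heg : ∀ i, Dep (e i) (g i)) (hne : ∀ i, e i ≠ f i) (hef : ∀ i, Dep (e i) (f i))
    (hfe : ∀ i, Dep (f i) (e i)) : IsIso G K4 ∨ IsIso G C6bar := by
  choose a ha1 ha2 ha3 using fun i => hG.exists_bipartition (hne i) (hef i) (hfe i)
  have hg : ∀ i b, Dep (if b = true then e i else f i) (g i) := by
    intro i b
    cases b
    · simpa using (hfe i).trans (heg i)
    · simpa using heg i
  let c : Config G :=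
    { a := a
      r := fun i b => if b = true then e i else f i
      mono := by
        rintro i (_ | _) v hv
        · exact ha2 i v (by simpa using hv)
        · exact ha1 i v (by simpa using hv)
      flip := fun i g u w hgu hgr => by
        have h1 := ha3 i g u w hgu (by simpa using hgr true) (by simpa using hgr false)
        exact Bool.eq_not.2 h1.symm
      pair := by
        rintro P i (_ | _) hP
        · simpa using hfe i P (by simpa using hP)
        · simpa using hef i P (by simpa using hP)
      excl := fun P i j b d h1 h2 =>
        hginj ((hg i b P h1).eq_of_mem (hg j d P h2) (hvg i) (hvg j)) }
  exact c.isIso_K4_or_C6bar hG hmax hvg hg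

end Multigraph

/-- Carvalho–Lucchesi–Murty: every brick different from `K₄` and `C̄₆` has at
least `Δ - 2` removable edges. -/
theorem brick_removable_edges_ge_maxDegree_sub_two
    (G : Multigraph) (hG : G.IsBrick)
    (hK4 : ¬ Multigraph.IsIso G K4) (hC6 : ¬ Multigraph.IsIso G C6bar) :
    G.maxDegree - 2 ≤ Nat.card {e : G.E // G.Removable e} := by
  classical
  have := hG.1.2.1.1
  obtain ⟨v, -, hv⟩ := Finset.exists_mem_eq_sup (Finset.univ : Finset G.V) Finset.univ_nonempty
    G.degree
  have hmax : ∀ u, G.degree u ≤ G.degree v := fun u =>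
    hv ▸ Finset.le_sup (f := G.degree) (Finset.mem_univ u)
  choose f hf hmin using fun g : G.E => exists_minimal_dep g
  have hinj : ∀ g g', v ∈ G.ends g → v ∈ G.ends g' → f g = f g' → g = g' := by
    intro g g' hg hg' hff
    obtain ⟨P, hP⟩ := hG.1.exists_pm (f g)
    exact (hf g P hP).eq_of_mem (hf g' P (hff ▸ hP)) hg hg'
  let D : Finset G.E := Finset.univ.filter fun g => v ∈ G.ends g
  have hD : G.maxDegree = D.card := by
    rw [show G.maxDegree = G.degree v from hv, ← Fintype.card_subtype, ← Nat.card_eq_fintype_card]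
    rfl
  have hbad : (D.filter fun g => ¬ G.Removable (f g)).card ≤ 2 := by
    by_contra! hlt
    obtain ⟨φ⟩ := Function.Embedding.nonempty_of_card_le (α := Fin 3)
      (β := ↥(D.filter fun g => ¬ G.Removable (f g))) (by
        rw [Fintype.card_coe, Fintype.card_fin]
        exact hlt)
    have hφ : ∀ i, v ∈ G.ends (φ i).1 ∧ ¬ G.Removable (f (φ i).1) := fun i => by
      obtain ⟨h1, h2⟩ := Finset.mem_filter.1 (φ i).2
      exact ⟨(Finset.mem_filter.1 h1).2, h2⟩
    choose h hne hdep using fun i => hG.exists_dep_of_not_removable (hφ i).2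
    rcases hG.isIso_of_dep hmax (fun i => (hφ i).1) (Subtype.val_injective.comp φ.injective)
      (fun i => hf (φ i).1) (fun i => (hne i).symm) (fun i => hmin _ _ (hdep i)) hdep with h1 | h1
    · exact hK4 h1
    · exact hC6 h1
  have hgood : (D.filter fun g => G.Removable (f g)).card ≤
      Nat.card {e : G.E // G.Removable e} := by
    rw [Nat.card_eq_fintype_card, Fintype.card_subtype]
    refine Finset.card_le_card_of_injOn f (fun g hg => ?_) fun g hg g' hg' => ?_
    · simp only [Finset.coe_filter, Set.mem_ofPred_eq] at hg
      simpa using hg.2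
    · simp only [Finset.coe_filter, Set.mem_ofPred_eq, D, Finset.mem_filter, Finset.mem_univ,
        true_and] at hg hg'
      exact hinj g g' hg.1 hg'.1
  have := Finset.card_filter_add_card_filter_not (s := D) fun g => G.Removable (f g)
  omega
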